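/- arXiv:1803.03752 — 5 statements merged into one kernel-verified Lean document; each statement's English description precedes it below -/
import Mathlib

section
/- Let F be a field, let k ≥ 1 and n ≥ k be integers, let G ∈ F^{k×n} be a matrix of rank k, and let S_1,…,S_k ⊆ {1,…,n} be sets such that G_{ij} = 0 for every i ∈ {1,…,k} and every j ∈ S_i. Let d be the minimum Hamming weight of a nonzero vector of the form mG with m ∈ F^{1×k}, m ≠ 0. Then for every nonempty Ω ⊆ {1,…,k}, d ≤ n − |∩_{i∈Ω} S_i| − |Ω| + 1; equivalently, d ≤ n + 1 − max over nonempty Ω ⊆ {1,…,k} of (|∩_{i∈Ω} S_i| + |Ω|). -/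
/-- A matrix whose rank equals its number of rows has injective `vecMul`. -/
theorem Matrix.vecMul_injective_of_rank_eq_card {F ι κ : Type*} [Field F] [Fintype ι] [Fintype κ]
    (G : Matrix ι κ F) (hG : G.rank = Fintype.card ι) :
    Function.Injective fun m => Matrix.vecMul m G := by
  refine Matrix.vecMul_injective_iff.mpr (linearIndependent_iff_card_eq_finrank_span.mpr ?_)
  rw [← hG, Matrix.rank_eq_finrank_span_row]
  rfl

/-- If `Ω` has more elements than `A`, some nonzero combination of the rows indexed by `Ω`
vanishes on `A`. -/
theorem Matrix.exists_vecMul_eq_zero_on {F ι κ : Type*} [Field F] [Fintype ι]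
    (G : Matrix ι κ F) (Ω : Finset ι) (A : Finset κ) (h : A.card < Ω.card) :
    ∃ m : ι → F, m ≠ 0 ∧ (∀ i ∉ Ω, m i = 0) ∧ ∀ j ∈ A, Matrix.vecMul m G j = 0 := by
  classical
  let N : Matrix Ω A F := G.submatrix Subtype.val Subtype.val
  have hker : LinearMap.ker N.vecMulLinear ≠ ⊥ :=
    LinearMap.ker_ne_bot_of_finrank_lt (by simpa using h)
  obtain ⟨v, hv, hv0⟩ := Submodule.exists_mem_ne_zero_of_ne_bot hker
  refine ⟨fun i => if hi : i ∈ Ω then v ⟨i, hi⟩ else 0, fun h0 => hv0 ?_, ?_, fun j hj => ?_⟩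
  · ext i
    simpa using congrFun h0 i
  · intro i hi
    simp [hi]
  · have hvj : ∑ i : Ω, v i * G i j = 0 := congrFun (LinearMap.mem_ker.mp hv) ⟨j, hj⟩
    rw [Matrix.vecMul, dotProduct, ← Finset.sum_subset (Finset.subset_univ Ω),
      ← Finset.sum_coe_sort Ω]
    · simpa using hvj
    · intro i _ hi
      simp [hi]

/-- **Singleton-type bound under support constraints.** Let `G ∈ F^{k×n}` have
rank `k`, with `G i j = 0` for all `j ∈ S i`, and let `d` be the minimum Hamming
weight of `m ⬝ G` over nonzero row vectors `m`.  Then for every nonempty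
`Ω ⊆ [k]`, `d ≤ n - |⋂_{i∈Ω} S_i| - |Ω| + 1`, stated here in the subtraction-free
form `d + |⋂_{i∈Ω} S_i| + |Ω| ≤ n + 1`. -/
theorem stmt_0 {F : Type*} [Field F] [DecidableEq F] {k n : ℕ}
    (hk : 1 ≤ k) (hkn : k ≤ n)
    (G : Matrix (Fin k) (Fin n) F) (hG : G.rank = k)
    (S : Fin k → Finset (Fin n)) (hzero : ∀ i, ∀ j ∈ S i, G i j = 0)
    (d : ℕ)
    (hd : IsLeast {w | ∃ m : Fin k → F, m ≠ 0 ∧ w = hammingNorm (Matrix.vecMul m G)} d) :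
    ∀ Ω : Finset (Fin k), Ω.Nonempty → d + (Ω.inf S).card + Ω.card ≤ n + 1 := by
  intro Ω hΩ
  have hinj := G.vecMul_injective_of_rank_eq_card (by simpa using hG)
  have hpos := hΩ.card_pos
  obtain ⟨A, hAT, hA⟩ := Finset.exists_subset_card_eq
    (min_le_right (Ω.card - 1) (Ω.inf S)ᶜ.card)
  obtain ⟨m, hm0, hmΩ, hmA⟩ := G.exists_vecMul_eq_zero_on Ω A (by omega)
  have hsupp : (Finset.univ.filter fun j => Matrix.vecMul m G j ≠ 0) ⊆ (Ω.inf S)ᶜ \ A := by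
    intro j hj
    have hj0 : Matrix.vecMul m G j ≠ 0 := (Finset.mem_filter.mp hj).2
    refine Finset.mem_sdiff.mpr ⟨Finset.mem_compl.mpr fun hjT => hj0 ?_, fun h => hj0 (hmA j h)⟩
    rw [Matrix.vecMul, dotProduct]
    refine Finset.sum_eq_zero fun i _ => ?_
    by_cases hi : i ∈ Ω
    · rw [hzero i j (Finset.inf_le (f := S) hi hjT), mul_zero]
    · rw [hmΩ i hi, zero_mul]
  have hle : hammingNorm (Matrix.vecMul m G) ≤ ((Ω.inf S)ᶜ \ A).card := Finset.card_le_card hsupp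
  have hne : 0 < hammingNorm (Matrix.vecMul m G) :=
    hammingNorm_pos_iff.mpr fun h => hm0 (hinj (by simpa using h))
  have hmin : d ≤ hammingNorm (Matrix.vecMul m G) := hd.2 ⟨m, hm0, rfl⟩
  rw [Finset.card_sdiff_of_subset hAT] at hle
  have hT := Finset.card_add_card_compl (Ω.inf S)
  rw [Fintype.card_fin] at hT
  omega
end

section
/- Let k ≥ 1, let S_1,…,S_k ⊆ {1,…,n}, and let ℓ = max over nonempty Ω ⊆ {1,…,k} of (|∩_{i∈Ω} S_i| + |Ω|). Assume ℓ ≤ n, and let q be a prime power with q ≥ n + ℓ − 1. Then there exist distinct elements α_1,…,α_n ∈ F_q and a matrix T ∈ F_q^{k×ℓ} of rank k such that the matrix G = T·V (where V ∈ F_q^{ℓ×n} is the Vandermonde matrix V_{ij} = α_j^{i−1}) satisfies G_{ij} = 0 for every i ∈ {1,…,k} and j ∈ S_i, and the minimum Hamming weight of mG over nonzero m ∈ F_q^{1×k} equals n − ℓ + 1. -/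
open Polynomial in
/-- The product of the `X - a j` over a multiset of generic points `a j`, given by its
multiplicities `w`. -/
noncomputable def genericProd (F : Type*) [Field F] {σ : Type*} [Fintype σ] (w : σ → ℕ) :
    (MvPolynomial σ F)[X] :=
  ∏ j, (X - C (MvPolynomial.X j)) ^ w j

/-- The multiplicity vectors `v i`, `i ∈ s`, together with the dimensions `d i`, satisfy the
Hall-type condition of the GM-MDS theorem in dimension `k`; only the point `z` may be repeated. -/
structure GMCondition {σ ρ : Type*} [Fintype σ] (z : σ) (k : ℕ) (s : Finset ρ)
    (v : ρ → σ → ℕ) (d : ρ → ℕ) : Prop where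
  le_one : ∀ i ∈ s, ∀ j, j ≠ z → v i j ≤ 1
  sum_add : ∀ i ∈ s, ∑ j, v i j + d i = k
  sum_le : ∀ I ⊆ s, I.Nonempty → ∀ w : σ → ℕ, (∀ i ∈ I, w ≤ v i) →
    ∑ j, w j + ∑ i ∈ I, d i ≤ k

open Polynomial in
/-- There is no nontrivial relation `∑ g i * genericProd (v i) = 0` with `deg (g i) < d i`. -/
def GenericIndep (F : Type*) [Field F] {σ ρ : Type*} [Fintype σ] (s : Finset ρ)
    (v : ρ → σ → ℕ) (d : ρ → ℕ) : Prop :=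
  ∀ g : ρ → (MvPolynomial σ F)[X], (∀ i ∈ s, (g i).degree < d i) →
    ∑ i ∈ s, g i * genericProd F (v i) = 0 → ∀ i ∈ s, g i = 0

/-- The multiplicities after the point `j` is moved to `z`. -/
def mergePoint {σ : Type*} [DecidableEq σ] (z j : σ) (w : σ → ℕ) : σ → ℕ :=
  Function.update (Function.update w j 0) z (w z + w j)

theorem mergePoint_self {σ : Type*} [DecidableEq σ] (z j : σ) (w : σ → ℕ) :
    mergePoint z j w z = w z + w j := by simp [mergePoint]

theorem mergePoint_src {σ : Type*} [DecidableEq σ] {z j : σ} (hj : j ≠ z) (w : σ → ℕ) :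
    mergePoint z j w j = 0 := by simp [mergePoint, hj]

theorem mergePoint_of_ne {σ : Type*} [DecidableEq σ] {z j i : σ} (hz : i ≠ z) (hj : i ≠ j)
    (w : σ → ℕ) : mergePoint z j w i = w i := by simp [mergePoint, hj, hz]

theorem sub_dvd_sub_aeval {F σ : Type*} [Field F] [DecidableEq σ] (z j : σ)
    (p : MvPolynomial σ F) : (MvPolynomial.X j - MvPolynomial.X z) ∣ p -
      MvPolynomial.aeval (fun i => if i = j then MvPolynomial.X z else MvPolynomial.X i :
        σ → MvPolynomial σ F) p := by
  induction p using MvPolynomial.induction_on with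
  | C a => simp
  | add p q hp hq =>
    rw [map_add, add_sub_add_comm]
    exact dvd_add hp hq
  | mul_X p i hp =>
    rw [map_mul, MvPolynomial.aeval_X]
    by_cases h : i = j
    · subst h
      rw [if_pos rfl]
      have := dvd_add (hp.mul_right (MvPolynomial.X i)) (Dvd.intro_left
        (MvPolynomial.aeval (fun i' => if i' = i then MvPolynomial.X z else MvPolynomial.X i' :
          σ → MvPolynomial σ F) p) rfl)
      convert this using 1
      ring
    · rw [if_neg h, ← sub_mul]
      exact hp.mul_right _

section
open Polynomial

variable {F : Type*} [Field F] {σ ρ : Type*} [Fintype σ] {z : σ} {k : ℕ}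
  {s : Finset ρ} {v : ρ → σ → ℕ} {d : ρ → ℕ}

theorem genericProd_add (w w' : σ → ℕ) :
    genericProd F (w + w') = genericProd F w * genericProd F w' := by
  simp [genericProd, pow_add, Finset.prod_mul_distrib]

theorem genericProd_single [DecidableEq σ] (t : σ) :
    genericProd F (Pi.single t 1) = X - C (MvPolynomial.X t : MvPolynomial σ F) := by
  unfold genericProd
  rw [Finset.prod_eq_single t]
  · simp
  · intro b _ hb; simp [hb]
  · simp

theorem monic_genericProd (w : σ → ℕ) : (genericProd F w).Monic :=
  monic_prod_of_monic _ _ fun _ _ => (monic_X_sub_C _).pow _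

theorem natDegree_genericProd (w : σ → ℕ) : (genericProd F w).natDegree = ∑ j, w j := by
  unfold genericProd
  rw [natDegree_prod_of_monic _ _ fun _ _ => (monic_X_sub_C _).pow _]
  simp [natDegree_pow]

theorem degree_genericProd (w : σ → ℕ) : (genericProd F w).degree = (∑ j, w j : ℕ) := by
  rw [degree_eq_natDegree (monic_genericProd w).ne_zero, natDegree_genericProd]

theorem genericProd_eval_ne_zero {w : σ → ℕ} {t : σ} (h : w t = 0) :
    (genericProd F w).eval (MvPolynomial.X t) ≠ 0 := by
  unfold genericProd
  rw [eval_prod, Finset.prod_ne_zero_iff]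
  intro j _
  by_cases hj : j = t
  · simp [hj, h]
  · simp only [eval_pow, eval_sub, eval_X, eval_C]
    exact pow_ne_zero _ (sub_ne_zero.2 fun e => hj (MvPolynomial.X_injective e).symm)

theorem sum_sub_single [DecidableEq σ] {w : σ → ℕ} {t : σ} (h : 1 ≤ w t) :
    ∑ j, (w - Pi.single t 1 : σ → ℕ) j + 1 = ∑ j, w j := by
  have e : w = (w - Pi.single t 1) + Pi.single t 1 := by
    funext j
    by_cases hj : j = t
    · subst hj; simp; omega
    · simp [hj]
  conv_rhs => rw [e]
  simp [Finset.sum_add_distrib]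

theorem genericProd_eq_mul_sub_single [DecidableEq σ] {w : σ → ℕ} {t : σ} (h : 1 ≤ w t) :
    genericProd F w = (X - C (MvPolynomial.X t)) * genericProd F (w - Pi.single t 1) := by
  rw [← genericProd_single, ← genericProd_add]
  congr 1
  funext j
  by_cases hj : j = t
  · subst hj; simp; omega
  · simp [hj]

theorem GMCondition.mono {s' : Finset ρ} (h : GMCondition z k s v d) (hs : s' ⊆ s) :
    GMCondition z k s' v d :=
  ⟨fun i hi => h.le_one i (hs hi), fun i hi => h.sum_add i (hs hi),
    fun I hI => h.sum_le I (hI.trans hs)⟩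

theorem GenericIndep.of_erase [DecidableEq ρ] {i₀ : ρ} (hd : d i₀ = 0)
    (h : GenericIndep F (s.erase i₀) v d) : GenericIndep F s v d := by
  intro g hg hsum
  have h0 : i₀ ∈ s → g i₀ = 0 := fun hi => by
    have := hg i₀ hi
    rw [hd] at this
    exact degree_eq_bot.1 (by simpa using this)
  by_cases hi : i₀ ∈ s
  · rw [← Finset.add_sum_erase _ _ hi, h0 hi, zero_mul, zero_add] at hsum
    intro i his
    by_cases e : i = i₀
    · rw [e, h0 hi]
    · exact h g (fun i hi => hg i (Finset.mem_of_mem_erase hi)) hsum i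
        (Finset.mem_erase.2 ⟨e, his⟩)
  · rw [Finset.erase_eq_of_notMem hi] at h
    exact h g hg hsum

/-- Cancelling a point common to all multiplicity vectors. -/
theorem GMCondition.sub_single [DecidableEq σ] {t : σ} (h : GMCondition z (k + 1) s v d)
    (ht : ∀ i ∈ s, 1 ≤ v i t) :
    GMCondition z k s (fun i => v i - Pi.single t 1) d := by
  refine ⟨fun i hi j hj => ?_, fun i hi => ?_, fun I hI hne w hw => ?_⟩
  · exact (Nat.sub_le _ _).trans (h.le_one i hi j hj)
  · have := h.sum_add i hi
    have := sum_sub_single (ht i hi)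
    omega
  · have := h.sum_le I hI hne (w + Pi.single t 1) fun i hi j => by
      have h1 := hw i hi j
      have h2 := ht i (hI hi)
      by_cases hj : j = t
      · subst hj; simp at h1 ⊢; omega
      · simpa [hj] using h1
    simp [Finset.sum_add_distrib] at this
    omega

theorem GenericIndep.of_sub_single [DecidableEq σ] {t : σ} (ht : ∀ i ∈ s, 1 ≤ v i t)
    (h : GenericIndep F s (fun i => v i - Pi.single t 1) d) : GenericIndep F s v d := by
  intro g hg hsum
  refine h g hg ?_
  rw [Finset.sum_congr rfl fun i hi => by
    rw [genericProd_eq_mul_sub_single (ht i hi), mul_left_comm], ← Finset.mul_sum] at hsum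
  exact (mul_eq_zero.1 hsum).resolve_left (X_sub_C_ne_zero _)

/-- Cancelling a point common to all multiplicity vectors but one. -/
theorem GMCondition.sub_single_of_ne [DecidableEq σ] [DecidableEq ρ] {t : σ} {i₀ : ρ}
    (h : GMCondition z (k + 1) s v d) (h0 : v i₀ t = 0) (hd : 0 < d i₀) (hi₀ : i₀ ∈ s)
    (ht : ∀ i ∈ s, i ≠ i₀ → 1 ≤ v i t) :
    GMCondition z k s (fun i => v i - Pi.single t 1) (Function.update d i₀ (d i₀ - 1)) := by
  have e0 : v i₀ - Pi.single t 1 = v i₀ := by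
    funext j
    by_cases hj : j = t
    · subst hj; simp [h0]
    · simp [hj]
  refine ⟨fun i hi j hj => ?_, fun i hi => ?_, fun I hI hne w hw => ?_⟩
  · exact (Nat.sub_le _ _).trans (h.le_one i hi j hj)
  · by_cases hi' : i = i₀
    · subst hi'
      have := h.sum_add i hi
      rw [e0]
      simp; omega
    · have := h.sum_add i hi
      have := sum_sub_single (ht i hi hi')
      simp [hi'] at this ⊢
      omega
  · by_cases hi : i₀ ∈ I
    · have := h.sum_le I hI hne w fun i hi j => (hw i hi j).trans (Nat.sub_le _ _)
      rw [← Finset.add_sum_erase _ _ hi] at this ⊢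
      rw [Finset.sum_update_of_notMem (Finset.notMem_erase _ _), Function.update_self]
      omega
    · have := h.sum_le I hI hne (w + Pi.single t 1) fun i hi' j => by
        have h1 := hw i hi' j
        have h2 := ht i (hI hi') (fun e => hi (e ▸ hi'))
        by_cases hj : j = t
        · subst hj; simp at h1 ⊢; omega
        · simpa [hj] using h1
      simp [Finset.sum_add_distrib] at this
      rw [Finset.sum_update_of_notMem hi]
      omega

theorem GenericIndep.of_sub_single_of_ne [DecidableEq σ] [DecidableEq ρ] {t : σ} {i₀ : ρ}
    (h0 : v i₀ t = 0) (hi₀ : i₀ ∈ s)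
    (ht : ∀ i ∈ s, i ≠ i₀ → 1 ≤ v i t)
    (h : GenericIndep F s (fun i => v i - Pi.single t 1) (Function.update d i₀ (d i₀ - 1))) :
    GenericIndep F s v d := by
  intro g hg hsum
  have e0 : v i₀ - Pi.single t 1 = v i₀ := by
    funext j
    by_cases hj : j = t
    · subst hj; simp [h0]
    · simp [hj]
  have hE : ∑ i ∈ s.erase i₀, g i * genericProd F (v i) = (X - C (MvPolynomial.X t)) *
      ∑ i ∈ s.erase i₀, g i * genericProd F (v i - Pi.single t 1) := by
    rw [Finset.mul_sum]
    refine Finset.sum_congr rfl fun i hi => ?_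
    rw [genericProd_eq_mul_sub_single
      (ht i (Finset.mem_of_mem_erase hi) (Finset.ne_of_mem_erase hi)), mul_left_comm]
  rw [← Finset.add_sum_erase _ _ hi₀, hE] at hsum
  have hroot : (g i₀).IsRoot (MvPolynomial.X t) := by
    have := congrArg (eval (MvPolynomial.X t : MvPolynomial σ F)) hsum
    simp only [eval_add, eval_mul, eval_sub, eval_X, eval_C, sub_self, zero_mul, add_zero,
      eval_zero] at this
    exact (mul_eq_zero.1 this).resolve_right (genericProd_eval_ne_zero h0)
  obtain ⟨q, hq⟩ := dvd_iff_isRoot.2 hroot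
  have key := h (Function.update g i₀ q) (fun i hi => ?_) ?_
  · intro i hi
    have := key i hi
    by_cases e : i = i₀
    · subst e
      rw [Function.update_self] at this
      rw [hq, this, mul_zero]
    · rwa [Function.update_of_ne e] at this
  · by_cases e : i = i₀
    · subst e
      rw [Function.update_self, Function.update_self]
      by_cases q0 : q = 0
      · rw [q0, degree_zero]; exact WithBot.bot_lt_coe _
      · have := hg i hi
        rw [hq, degree_mul, degree_X_sub_C, degree_eq_natDegree q0] at this
        rw [degree_eq_natDegree q0]
        norm_cast at this ⊢
        omega
    · rw [Function.update_of_ne e, Function.update_of_ne e]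
      exact hg i hi
  · have hcongr : ∑ i ∈ s.erase i₀,
        Function.update g i₀ q i * genericProd F (v i - Pi.single t 1) =
        ∑ i ∈ s.erase i₀, g i * genericProd F (v i - Pi.single t 1) :=
      Finset.sum_congr rfl fun i hi => by
        rw [Function.update_of_ne (Finset.ne_of_mem_erase hi)]
    simp only [← Finset.add_sum_erase _ _ hi₀, Function.update_self, e0, hcongr]
    rw [hq, mul_assoc, ← mul_add] at hsum
    exact (mul_eq_zero.1 hsum).resolve_left (X_sub_C_ne_zero _)

/-- Replacing the vectors indexed by a tight set `I` by a common lower bound. -/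
theorem GMCondition.contract [DecidableEq ρ] {I : Finset ρ} {i₀ : ρ} {w : σ → ℕ}
    (h : GMCondition z k s v d) (hI : I ⊆ s) (hi₀ : i₀ ∈ I) (hw : ∀ i ∈ I, w ≤ v i)
    (htight : ∑ j, w j + ∑ i ∈ I, d i = k) :
    GMCondition z k (insert i₀ (s \ I)) (Function.update v i₀ w)
      (Function.update d i₀ (∑ i ∈ I, d i)) := by
  have hne : ∀ i ∈ s \ I, i ≠ i₀ := fun i hi e => (Finset.mem_sdiff.1 hi).2 (e ▸ hi₀)
  refine ⟨fun i hi j hj => ?_, fun i hi => ?_, fun J hJ hJne w' hw' => ?_⟩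
  · rcases Finset.mem_insert.1 hi with rfl | hi
    · simpa using (hw i hi₀ j).trans (h.le_one i (hI hi₀) j hj)
    · rw [Function.update_of_ne (hne i hi)]
      exact h.le_one i (Finset.mem_sdiff.1 hi).1 j hj
  · rcases Finset.mem_insert.1 hi with rfl | hi
    · simpa using htight
    · rw [Function.update_of_ne (hne i hi), Function.update_of_ne (hne i hi)]
      exact h.sum_add i (Finset.mem_sdiff.1 hi).1
  · have hJ' : J.erase i₀ ⊆ s \ I := fun i hi =>
      (Finset.mem_insert.1 (hJ (Finset.mem_of_mem_erase hi))).resolve_left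
        (Finset.ne_of_mem_erase hi)
    by_cases hi : i₀ ∈ J
    · have := h.sum_le (I ∪ J.erase i₀)
        (Finset.union_subset hI (hJ'.trans Finset.sdiff_subset)) ⟨i₀, by simp [hi₀]⟩ w' ?_
      · rw [Finset.sum_union] at this
        · rw [← Finset.add_sum_erase _ _ hi, Function.update_self,
            Finset.sum_update_of_notMem (Finset.notMem_erase _ _)]
          exact this
        · exact Finset.disjoint_of_subset_right hJ' Finset.disjoint_sdiff
      · intro i hi'
        rcases Finset.mem_union.1 hi' with hi' | hi'
        · have := hw' i₀ hi
          rw [Function.update_self] at this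
          exact this.trans (hw i hi')
        · have := hw' i (Finset.mem_of_mem_erase hi')
          rwa [Function.update_of_ne (Finset.ne_of_mem_erase hi')] at this
    · rw [Finset.erase_eq_of_notMem hi] at hJ'
      rw [Finset.sum_update_of_notMem hi]
      refine h.sum_le J (hJ'.trans Finset.sdiff_subset) hJne w' fun i hi' => ?_
      have := hw' i hi'
      rwa [Function.update_of_ne (hne i (hJ' hi'))] at this

theorem GenericIndep.of_contract [DecidableEq ρ] {I : Finset ρ} {i₀ : ρ} {w : σ → ℕ}
    (h : GMCondition z k s v d) (hI : I ⊆ s) (hi₀ : i₀ ∈ I) (hw : ∀ i ∈ I, w ≤ v i)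
    (htight : ∑ j, w j + ∑ i ∈ I, d i = k) (hIindep : GenericIndep F I v d)
    (hind : GenericIndep F (insert i₀ (s \ I)) (Function.update v i₀ w)
      (Function.update d i₀ (∑ i ∈ I, d i))) : GenericIndep F s v d := by
  intro g hg hsum
  have hne : ∀ i ∈ s \ I, i ≠ i₀ := fun i hi e => (Finset.mem_sdiff.1 hi).2 (e ▸ hi₀)
  have hi₀' : i₀ ∉ s \ I := fun hi => hne _ hi rfl
  set q := ∑ i ∈ I, g i * genericProd F (v i - w) with hq
  have hqI : q * genericProd F w = ∑ i ∈ I, g i * genericProd F (v i) := by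
    rw [hq, Finset.sum_mul]
    refine Finset.sum_congr rfl fun i hi => ?_
    rw [mul_assoc, ← genericProd_add]
    congr 2
    exact tsub_add_cancel_of_le (hw i hi)
  have key := hind (Function.update g i₀ q) (fun i hi => ?_) ?_
  · have q0 : q = 0 := by simpa using key i₀ (Finset.mem_insert_self _ _)
    rw [q0, zero_mul] at hqI
    intro i hi
    by_cases hiI : i ∈ I
    · exact hIindep g (fun i hi => hg i (hI hi)) hqI.symm i hiI
    · have hi' := Finset.mem_sdiff.2 ⟨hi, hiI⟩
      have := key i (Finset.mem_insert_of_mem hi')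
      rwa [Function.update_of_ne (hne i hi')] at this
  · rcases Finset.mem_insert.1 hi with rfl | hi
    · rw [Function.update_self, Function.update_self]
      refine (degree_sum_le _ _).trans_lt ((Finset.sup_lt_iff (WithBot.bot_lt_coe _)).2 ?_)
      intro i' hi'
      by_cases g0 : g i' = 0
      · rw [g0, zero_mul, degree_zero]; exact WithBot.bot_lt_coe _
      · have h1 := hg i' (hI hi')
        have h2 := h.sum_add i' (hI hi')
        have h3 : ∑ j, (v i' - w) j + ∑ j, w j = ∑ j, v i' j := by
          rw [← Finset.sum_add_distrib]
          exact Finset.sum_congr rfl fun j _ => Nat.sub_add_cancel (hw i' hi' j)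
        rw [degree_mul, degree_genericProd, degree_eq_natDegree g0]
        rw [degree_eq_natDegree g0] at h1
        norm_cast at h1 ⊢
        omega
    · rw [Function.update_of_ne (hne i hi), Function.update_of_ne (hne i hi)]
      exact hg i (Finset.mem_sdiff.1 hi).1
  · have hcongr : ∑ i ∈ s \ I, Function.update g i₀ q i *
        genericProd F (Function.update v i₀ w i) = ∑ i ∈ s \ I, g i * genericProd F (v i) :=
      Finset.sum_congr rfl fun i hi => by
        rw [Function.update_of_ne (hne i hi), Function.update_of_ne (hne i hi)]
    rw [Finset.sum_insert hi₀', Function.update_self, Function.update_self, hqI, hcongr,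
      add_comm, Finset.sum_sdiff hI, hsum]

theorem prod_pow_mergePoint [DecidableEq σ] {M : Type*} [CommMonoid M] {z j : σ} (hj : j ≠ z)
    (w : σ → ℕ) (f : σ → M) :
    ∏ i, f i ^ mergePoint z j w i = ∏ i, (if i = j then f z else f i) ^ w i := by
  have hz : z ∈ Finset.univ.erase j := by simp [hj.symm]
  rw [← Finset.mul_prod_erase _ _ (Finset.mem_univ j),
    ← Finset.mul_prod_erase _ (fun i => (if i = j then f z else f i) ^ w i) (Finset.mem_univ j),
    ← Finset.mul_prod_erase _ _ hz,
    ← Finset.mul_prod_erase _ (fun i => (if i = j then f z else f i) ^ w i) hz,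
    mergePoint_src hj, mergePoint_self, if_pos rfl, if_neg hj.symm, pow_zero, one_mul,
    ← mul_assoc, ← pow_add, add_comm (w z)]
  congr 1
  refine Finset.prod_congr rfl fun i hi => ?_
  simp only [Finset.mem_erase, Finset.mem_univ, and_true] at hi
  rw [mergePoint_of_ne hi.1 hi.2, if_neg hi.2]

theorem sum_mergePoint [DecidableEq σ] {z j : σ} (hj : j ≠ z) (w : σ → ℕ) :
    ∑ i, mergePoint z j w i = ∑ i, w i := by
  have := prod_pow_mergePoint hj w (fun _ => Multiplicative.ofAdd 1)
  simp only [ite_self, ← ofAdd_nsmul, smul_eq_mul, mul_one] at this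
  exact Multiplicative.ofAdd.injective this

theorem genericProd_mergePoint [DecidableEq σ] {z j : σ} (hj : j ≠ z) (w : σ → ℕ) :
    genericProd F (mergePoint z j w) = (genericProd F w).map
      (MvPolynomial.aeval fun i => if i = j then MvPolynomial.X z else MvPolynomial.X i :
        MvPolynomial σ F →ₐ[F] MvPolynomial σ F).toRingHom := by
  unfold genericProd
  rw [prod_pow_mergePoint hj, Polynomial.map_prod]
  refine Finset.prod_congr rfl fun i _ => ?_
  simp only [Polynomial.map_pow, Polynomial.map_sub, map_X, map_C]
  congr 2
  by_cases h : i = j <;> simp [h]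

/-- Independence may be checked after two generic points are identified. -/
theorem GenericIndep.of_mergePoint [DecidableEq σ] {j : σ} (hj : j ≠ z)
    (h : GenericIndep F s (fun i => mergePoint z j (v i)) d) : GenericIndep F s v d := by
  set φ : MvPolynomial σ F →ₐ[F] MvPolynomial σ F :=
    MvPolynomial.aeval fun i => if i = j then MvPolynomial.X z else MvPolynomial.X i with hφ
  set π : MvPolynomial σ F := MvPolynomial.X j - MvPolynomial.X z with hπ
  have hφπ : φ π = 0 := by simp [hφ, hπ, hj.symm]
  have hπ0 : π ≠ 0 := sub_ne_zero.2 fun e => hj (MvPolynomial.X_injective e)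
  have hπu : ¬ IsUnit π := fun hu => by simpa [hφπ] using hu.map φ
  have main : ∀ c : MvPolynomial σ F, c ≠ 0 → ∀ g : ρ → (MvPolynomial σ F)[X],
      (∀ i ∈ s, (g i).degree < d i) → ∑ i ∈ s, g i * genericProd F (v i) = 0 →
      ∀ i ∈ s, ∀ e, (g i).coeff e = c → False := by
    intro c
    induction c using WellFounded.induction (wellFounded_dvdNotUnit (α := MvPolynomial σ F)) with
    | _ c ih =>
    intro hc g hg hsum i hi e hgc
    have hz : ∀ i ∈ s, (g i).map φ.toRingHom = 0 := by
      refine h (fun i => (g i).map φ.toRingHom)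
        (fun i hi => degree_map_le.trans_lt (hg i hi)) ?_
      have := congrArg (Polynomial.map φ.toRingHom) hsum
      rw [Polynomial.map_sum, Polynomial.map_zero] at this
      rw [← this]
      refine Finset.sum_congr rfl fun i _ => ?_
      rw [Polynomial.map_mul, genericProd_mergePoint hj]
    have hdvd : ∀ i ∈ s, C π ∣ g i := by
      intro i hi
      rw [C_dvd_iff_dvd_coeff]
      intro e
      have h1 : φ ((g i).coeff e) = 0 := by
        have := congrArg (fun p => p.coeff e) (hz i hi)
        simpa [coeff_map] using this
      have h2 := sub_dvd_sub_aeval z j ((g i).coeff e)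
      rwa [← hφ, h1, sub_zero] at h2
    choose! g' hg' using hdvd
    have hc' : c = π * (g' i).coeff e := by rw [← hgc, hg' i hi, coeff_C_mul]
    have hc'0 : (g' i).coeff e ≠ 0 := fun h0 => hc (by rw [hc', h0, mul_zero])
    refine ih _ ⟨hc'0, π, hπu, by rw [hc', mul_comm]⟩ hc'0 g' (fun i hi => ?_) ?_ i hi e rfl
    · have := hg i hi
      rwa [hg' i hi, degree_C_mul hπ0] at this
    · rw [Finset.sum_congr rfl fun i hi => by rw [hg' i hi, mul_assoc], ← Finset.mul_sum] at hsum
      exact (mul_eq_zero.1 hsum).resolve_left (C_ne_zero.2 hπ0)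
  intro g hg hsum i hi
  ext1 e
  by_contra hne
  exact main _ hne g hg hsum i hi e rfl

/-- In the absence of tight proper subsets, a point can be moved to `z`. -/
theorem GMCondition.mergePoint [DecidableEq σ] {j : σ} {c : ρ} (h : GMCondition z k s v d)
    (hj : j ≠ z) (hc : c ∈ s) (hcj : v c j = 0) (hcz : v c z = 0)
    (hnt : ∀ I ⊆ s, I ≠ s → 2 ≤ I.card → ∀ w : σ → ℕ, (∀ i ∈ I, w ≤ v i) →
      ∑ j, w j + ∑ i ∈ I, d i ≠ k) :
    GMCondition z k s (fun i => mergePoint z j (v i)) d := by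
  refine ⟨fun i hi t ht => ?_, fun i hi => ?_, fun I hI hne w hw => ?_⟩
  · by_cases htj : t = j
    · subst htj; simp [mergePoint_src ht]
    · rw [mergePoint_of_ne ht htj]; exact h.le_one i hi t ht
  · rw [sum_mergePoint hj]; exact h.sum_add i hi
  have hw_of_ne : ∀ i ∈ I, ∀ t, t ≠ z → w t ≤ v i t := by
    intro i hi t ht
    by_cases htj : t = j
    · have := hw i hi j
      simp only [mergePoint_src hj] at this
      rw [htj]; omega
    · have := hw i hi t
      simpa only [mergePoint_of_ne ht htj] using this
  by_cases hIs : I = s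
  · subst hIs
    refine h.sum_le I hI hne w fun i hi t => ?_
    by_cases ht : t = z
    · have := hw c hc z
      simp only [mergePoint_self] at this
      rw [ht]
      change w z ≤ v i z
      omega
    · exact hw_of_ne i hi t ht
  by_cases hcard : 2 ≤ I.card
  · set w' := Function.update w z (w z - 1) with hw'
    have hle : ∀ i ∈ I, w' ≤ v i := by
      intro i hi t
      by_cases ht : t = z
      · have h1 := hw i hi z
        have h2 := h.le_one i (hI hi) j hj
        simp only [mergePoint_self] at h1
        subst ht
        simp only [hw', Function.update_self]; omega
      · simpa only [hw', Function.update_of_ne ht] using hw_of_ne i hi t ht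
    have h1 := h.sum_le I hI hne w' hle
    have h2 := hnt I hI hIs hcard w' hle
    have h3 : ∑ t, w t ≤ ∑ t, w' t + 1 := by
      rw [← Finset.add_sum_erase _ w (Finset.mem_univ z),
        ← Finset.add_sum_erase _ w' (Finset.mem_univ z),
        Finset.sum_congr rfl fun t ht => by
          rw [show w t = w' t by simp [hw', Finset.ne_of_mem_erase ht]]]
      simp only [hw', Function.update_self]; omega
    omega
  · have hpos := Finset.card_pos.2 hne
    obtain ⟨i, rfl⟩ := Finset.card_eq_one.1 (show I.card = 1 by omega)
    have hi : i ∈ s := hI (Finset.mem_singleton_self i)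
    have h1 := h.sum_add i hi
    have h2 : ∑ t, w t ≤ ∑ t, _root_.mergePoint z j (v i) t :=
      Finset.sum_le_sum fun t _ => hw i (Finset.mem_singleton_self i) t
    rw [sum_mergePoint hj] at h2
    rw [Finset.sum_singleton]; omega

/-- The algebraic form of the GM-MDS theorem. -/
theorem GMCondition.genericIndep (F : Type*) [Field F] (h : GMCondition z k s v d) :
    GenericIndep F s v d := by
  classical
  obtain ⟨m, hm⟩ : ∃ m, s.card = m := ⟨_, rfl⟩
  obtain ⟨T, hT⟩ : ∃ T, ∑ i ∈ s, ∑ j ∈ Finset.univ.erase z, v i j = T := ⟨_, rfl⟩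
  induction k using Nat.strong_induction_on generalizing s v d m T with
  | _ k ihk =>
  induction m using Nat.strong_induction_on generalizing s v d T with
  | _ m ihm =>
  induction T using Nat.strong_induction_on generalizing s v d with
  | _ T ihT =>
  by_cases hd : ∃ i ∈ s, d i = 0
  · obtain ⟨i, hi, hdi⟩ := hd
    exact .of_erase hdi (ihm _ (hm ▸ Finset.card_erase_lt_of_mem hi)
      (h.mono (Finset.erase_subset _ _)) rfl _ rfl)
  push Not at hd
  by_cases hzero : ∃ t, ∃ i₀ ∈ s, ∀ i ∈ s, i ≠ i₀ → 1 ≤ v i t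
  · obtain ⟨t, i₀, hi₀, ht⟩ := hzero
    obtain ⟨k, rfl⟩ : ∃ k', k = k' + 1 := Nat.exists_eq_succ_of_ne_zero <| by
      have := h.sum_add i₀ hi₀
      have := hd i₀ hi₀
      omega
    by_cases h0 : v i₀ t = 0
    · exact .of_sub_single_of_ne h0 hi₀ ht (ihk k k.lt_succ_self
        (h.sub_single_of_ne h0 (Nat.pos_of_ne_zero (hd i₀ hi₀)) hi₀ ht) _ rfl _ rfl)
    · have ht' : ∀ i ∈ s, 1 ≤ v i t := fun i hi => by
        by_cases e : i = i₀
        · rw [e]; omega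
        · exact ht i hi e
      exact .of_sub_single ht' (ihk k k.lt_succ_self (h.sub_single ht') _ rfl _ rfl)
  push Not at hzero
  by_cases htight : ∃ I ⊆ s, I ≠ s ∧ 2 ≤ I.card ∧ ∃ w : σ → ℕ, (∀ i ∈ I, w ≤ v i) ∧
      ∑ j, w j + ∑ i ∈ I, d i = k
  · obtain ⟨I, hI, hIs, hcard, w, hw, hwk⟩ := htight
    obtain ⟨i₀, hi₀⟩ : I.Nonempty := Finset.card_pos.1 (by omega)
    have hlt : I.card < s.card := Finset.card_lt_card (hI.ssubset_of_ne hIs)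
    refine .of_contract h hI hi₀ hw hwk (ihm _ (hm ▸ hlt) (h.mono hI) rfl _ rfl)
      (ihm _ ?_ (h.contract hI hi₀ hw hwk) rfl _ rfl)
    have := Finset.card_insert_le i₀ (s \ I)
    have := Finset.card_sdiff_of_subset hI
    omega
  push Not at htight
  rcases s.eq_empty_or_nonempty with rfl | ⟨i₁, hi₁⟩
  · intro g _ _ i hi; simp at hi
  obtain ⟨a, ha, -, haz⟩ := hzero z i₁ hi₁
  obtain ⟨b, hb, hba, hbz⟩ := hzero z a ha
  have hab : v a ≠ v b := by
    intro e
    have h1 := h.sum_le {a, b} (by simp [Finset.insert_subset_iff, ha, hb]) ⟨a, by simp⟩ (v a)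
      (by simp [e])
    rw [Finset.sum_pair hba.symm] at h1
    have := h.sum_add a ha
    have := hd b hb
    omega
  obtain ⟨j, hj⟩ := Function.ne_iff.1 hab
  have hjz : j ≠ z := fun e => by subst e; omega
  have haj := h.le_one a ha j hjz
  have hbj := h.le_one b hb j hjz
  obtain ⟨c, hc, hcj, hcz⟩ : ∃ c ∈ s, v c j = 0 ∧ v c z = 0 := by
    by_cases e : v a j = 0
    · exact ⟨a, ha, e, by omega⟩
    · exact ⟨b, hb, by omega, by omega⟩
  obtain ⟨c', hc', hc'j⟩ : ∃ c' ∈ s, v c' j ≠ 0 := by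
    by_cases e : v a j = 0
    · exact ⟨b, hb, by omega⟩
    · exact ⟨a, ha, e⟩
  refine .of_mergePoint hjz (ihT _ ?_
    (h.mergePoint hjz hc hcj hcz fun I hI hIs h2 w hw => htight I hI hIs h2 w hw) hm rfl)
  rw [← hT]
  have hle : ∀ i, ∀ t ∈ Finset.univ.erase z, _root_.mergePoint z j (v i) t ≤ v i t := by
    intro i t ht
    by_cases e : t = j
    · rw [e, mergePoint_src hjz]; omega
    · rw [mergePoint_of_ne (Finset.ne_of_mem_erase ht) e]
  refine Finset.sum_lt_sum (fun i _ => Finset.sum_le_sum (hle i)) ⟨c', hc', ?_⟩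
  refine Finset.sum_lt_sum (hle c') ⟨j, by simp [hjz], ?_⟩
  rw [mergePoint_src hjz]; omega

end

section
open Polynomial

variable {F : Type*} [Field F] {σ : Type*}

theorem degreeOf_coeff_mul_le {p q : (MvPolynomial σ F)[X]} {t : σ} {a b : ℕ}
    (hp : ∀ e, (p.coeff e).degreeOf t ≤ a) (hq : ∀ e, (q.coeff e).degreeOf t ≤ b) (e : ℕ) :
    ((p * q).coeff e).degreeOf t ≤ a + b := by
  rw [coeff_mul]
  refine (MvPolynomial.degreeOf_sum_le _ _ _).trans (Finset.sup_le fun x _ => ?_)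
  exact (MvPolynomial.degreeOf_mul_le _ _ _).trans (add_le_add (hp _) (hq _))

theorem degreeOf_coeff_pow_le {p : (MvPolynomial σ F)[X]} {t : σ} {a : ℕ}
    (hp : ∀ e, (p.coeff e).degreeOf t ≤ a) (m e : ℕ) :
    ((p ^ m).coeff e).degreeOf t ≤ m * a := by
  induction m generalizing e with
  | zero =>
    rw [pow_zero, coeff_one]
    split_ifs <;> simp
  | succ m ih =>
    rw [pow_succ, Nat.succ_mul]
    exact degreeOf_coeff_mul_le ih hp e

theorem degreeOf_coeff_prod_le {ι : Type*} (s : Finset ι) {p : ι → (MvPolynomial σ F)[X]} {t : σ}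
    {a : ι → ℕ} (hp : ∀ i ∈ s, ∀ e, ((p i).coeff e).degreeOf t ≤ a i) (e : ℕ) :
    ((∏ i ∈ s, p i).coeff e).degreeOf t ≤ ∑ i ∈ s, a i := by
  classical
  induction s using Finset.induction_on generalizing e with
  | empty =>
    rw [Finset.prod_empty, coeff_one]
    split_ifs <;> simp
  | insert i s hi ih =>
    rw [Finset.prod_insert hi, Finset.sum_insert hi]
    exact degreeOf_coeff_mul_le (hp i (Finset.mem_insert_self _ _))
      (ih fun i hi => hp i (Finset.mem_insert_of_mem hi)) e

theorem degreeOf_coeff_genericProd_le [Fintype σ] (w : σ → ℕ) (t : σ) (e : ℕ) :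
    ((genericProd F w).coeff e).degreeOf t ≤ w t := by
  classical
  have h : ∀ j e, ((X - C (MvPolynomial.X j : MvPolynomial σ F)).coeff e).degreeOf t ≤
      if t = j then 1 else 0 := by
    intro j e
    rw [coeff_sub, coeff_X, coeff_C]
    refine (MvPolynomial.degreeOf_sub_le _ _ _).trans (max_le ?_ ?_)
    · split_ifs <;> simp
    · split_ifs <;> simp [MvPolynomial.degreeOf_X, *]
  refine (degreeOf_coeff_prod_le _ (fun j _ => degreeOf_coeff_pow_le (h j) (w j)) e).trans ?_
  simp

theorem degreeOf_det_le {ι : Type*} [Fintype ι] [DecidableEq ι]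
    (M : Matrix ι ι (MvPolynomial σ F)) (t : σ) (c : ℕ)
    (h : ∀ τ : Equiv.Perm ι, ∑ i, (M (τ i) i).degreeOf t ≤ c) : M.det.degreeOf t ≤ c := by
  rw [Matrix.det_apply']
  refine (MvPolynomial.degreeOf_sum_le _ _ _).trans (Finset.sup_le fun τ _ => ?_)
  refine (MvPolynomial.degreeOf_mul_le _ _ _).trans ?_
  have h1 : MvPolynomial.degreeOf t
      (((Equiv.Perm.sign τ : ℤ) : MvPolynomial σ F)) = 0 := by
    rw [← map_intCast (MvPolynomial.C : F →+* MvPolynomial σ F), MvPolynomial.degreeOf_C]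
  rw [h1, zero_add]
  exact (MvPolynomial.degreeOf_prod_le _ _ _).trans (h τ)

/-- The coefficient matrix of the generic products. -/
noncomputable def genericCoeff (F : Type*) [Field F] [Fintype σ] {ℓ : ℕ} (v : Fin ℓ → σ → ℕ) :
    Matrix (Fin ℓ) (Fin ℓ) (MvPolynomial σ F) :=
  Matrix.of fun i e => (genericProd F (v i)).coeff e

theorem GMCondition.det_genericCoeff_ne_zero (F : Type*) [Field F] [Fintype σ] {z : σ} {ℓ : ℕ}
    {v : Fin ℓ → σ → ℕ} (h : GMCondition z ℓ Finset.univ v fun _ => 1) :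
    (genericCoeff F v).det ≠ 0 := by
  intro hdet
  obtain ⟨c, hc, hcM⟩ := Matrix.exists_vecMul_eq_zero_iff.2 hdet
  refine hc (funext fun i => ?_)
  have := h.genericIndep F (fun i => C (c i))
    (fun i _ => degree_C_le.trans_lt (by norm_num)) ?_ i (Finset.mem_univ i)
  · exact C_eq_zero.1 this
  · ext1 e
    simp only [finsetSum_coeff, coeff_C_mul, coeff_zero]
    by_cases he : e < ℓ
    · have := congrFun hcM ⟨e, he⟩
      simpa [Matrix.vecMul, dotProduct, genericCoeff] using this
    · refine Finset.sum_eq_zero fun i _ => ?_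
      rw [coeff_eq_zero_of_natDegree_lt, mul_zero]
      have := h.sum_add i (Finset.mem_univ i)
      rw [natDegree_genericProd]
      omega

open Classical in
theorem degreeOf_det_vandermonde_X_le {τ : Type*} (n : ℕ) (f : Fin n → τ)
    (hf : Function.Injective f) (t : τ) :
    (Matrix.vandermonde fun j => (MvPolynomial.X (f j) : MvPolynomial τ F)).det.degreeOf t ≤
      if t ∈ Set.range f then n - 1 else 0 := by
  refine degreeOf_det_le _ _ _ fun p => ?_
  have hle : ∀ i, (Matrix.vandermonde (fun j => (MvPolynomial.X (f j) : MvPolynomial τ F))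
      (p i) i).degreeOf t ≤ if f (p i) = t then (i : ℕ) else 0 := by
    intro i
    rw [Matrix.vandermonde_apply]
    refine (MvPolynomial.degreeOf_pow_le _ _ _).trans ?_
    rw [MvPolynomial.degreeOf_X]
    by_cases h : t = f (p i)
    · simp [h]
    · simp [h, Ne.symm h]
  refine (Finset.sum_le_sum fun i _ => hle i).trans ?_
  split_ifs with ht
  · obtain ⟨j, rfl⟩ := ht
    rw [Finset.sum_eq_single (p.symm j)]
    · have := (p.symm j).2
      split_ifs <;> omega
    · intro i _ hi
      rw [if_neg fun e => hi (by rw [← hf e, Equiv.symm_apply_apply])]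
    · simp
  · exact (Finset.sum_eq_zero fun i _ => if_neg fun e => ht ⟨p i, e⟩).le

end

section

/-- Multiplicities of the zeros of the `i`-th row: the prescribed set `S i`, completed to total
multiplicity `ℓ - 1` by points used by no other row. -/
def paddedMult {n ℓ : ℕ} (S : Fin ℓ → Finset (Fin n)) (i : Fin ℓ) :
    Fin n ⊕ Fin ℓ × Fin ℓ → ℕ
  | .inl j => if j ∈ S i then 1 else 0
  | .inr (i', e) => if i' = i ∧ (e : ℕ) < ℓ - 1 - (S i).card then 1 else 0

variable {n ℓ : ℕ} {S : Fin ℓ → Finset (Fin n)}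

theorem paddedMult_le_one (i : Fin ℓ) (t : Fin n ⊕ Fin ℓ × Fin ℓ) : paddedMult S i t ≤ 1 := by
  rcases t with j | ⟨i', e⟩ <;> simp only [paddedMult] <;> split_ifs <;> omega

theorem sum_paddedMult (i : Fin ℓ) (h : (S i).card + 1 ≤ ℓ) :
    ∑ t, paddedMult S i t + 1 = ℓ := by
  have h1 : ∑ e : Fin ℓ, (if (e : ℕ) < ℓ - 1 - (S i).card then 1 else 0) =
      ℓ - 1 - (S i).card := by
    rw [Fin.sum_univ_eq_sum_range (fun e => if e < ℓ - 1 - (S i).card then 1 else 0),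
      ← Finset.sum_filter, ← Finset.card_eq_sum_ones,
      show (Finset.range ℓ).filter (· < ℓ - 1 - (S i).card) =
        Finset.range (ℓ - 1 - (S i).card) by ext; simp; omega, Finset.card_range]
  have h2 : ∑ x : Fin ℓ × Fin ℓ, paddedMult S i (.inr x) = ℓ - 1 - (S i).card := by
    rw [Fintype.sum_prod_type, Finset.sum_eq_single i]
    · simpa [paddedMult] using h1
    · intro b _ hb; simp [paddedMult, hb]
    · simp
  rw [Fintype.sum_sum_type, h2]
  simp [paddedMult]
  omega

theorem gmCondition_paddedMult (z : Fin n ⊕ Fin ℓ × Fin ℓ)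
    (h : ∀ Ω : Finset (Fin ℓ), Ω.Nonempty → (Ω.inf S).card + Ω.card ≤ ℓ) :
    GMCondition z ℓ Finset.univ (paddedMult S) fun _ => 1 := by
  have hsum : ∀ i, ∑ t, paddedMult S i t + 1 = ℓ := fun i =>
    sum_paddedMult i (by simpa using h {i} ⟨i, by simp⟩)
  refine ⟨fun i _ j _ => paddedMult_le_one i j, fun i _ => hsum i, fun I _ hne w hw => ?_⟩
  rw [← Finset.card_eq_sum_ones]
  by_cases hcard : I.card = 1
  · obtain ⟨i, rfl⟩ := Finset.card_eq_one.1 hcard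
    have := hsum i
    have : ∑ t, w t ≤ ∑ t, paddedMult S i t :=
      Finset.sum_le_sum fun t _ => hw i (Finset.mem_singleton_self i) t
    omega
  · have hr : ∀ x, w (.inr x) = 0 := by
      rintro ⟨i', e⟩
      obtain ⟨i, hi, hii'⟩ : ∃ i ∈ I, i ≠ i' := by
        by_contra! hcon
        exact hcard (Finset.card_eq_one.2 ⟨i', Finset.eq_singleton_iff_nonempty_unique_mem.2
          ⟨hne, hcon⟩⟩)
      simpa [paddedMult, hii'.symm] using hw i hi (.inr (i', e))
    have hl : ∀ j, w (.inl j) ≤ if j ∈ I.inf S then 1 else 0 := by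
      intro j
      split_ifs with hj
      · obtain ⟨i, hi⟩ := hne
        exact (hw i hi _).trans (paddedMult_le_one i _)
      · rw [Finset.mem_inf] at hj
        push Not at hj
        obtain ⟨i, hi, hij⟩ := hj
        simpa [paddedMult, hij] using hw i hi (.inl j)
    have : ∑ j, w (.inl j) ≤ (I.inf S).card := by
      simpa using Finset.sum_le_sum fun j (_ : j ∈ Finset.univ) => hl j
    rw [Fintype.sum_sum_type, Finset.sum_eq_zero fun x _ => hr x]
    have := h I hne
    omega

theorem card_filter_mem_lt (hℓ : 0 < ℓ)
    (h : ∀ Ω : Finset (Fin ℓ), Ω.Nonempty → (Ω.inf S).card + Ω.card ≤ ℓ) (j : Fin n) :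
    (Finset.univ.filter fun i => j ∈ S i).card < ℓ := by
  rcases (Finset.univ.filter fun i => j ∈ S i).eq_empty_or_nonempty with h0 | hne
  · simpa [h0] using hℓ
  · have h1 := h _ hne
    have h2 : 0 < ((Finset.univ.filter fun i => j ∈ S i).inf S).card :=
      Finset.card_pos.2 ⟨j, by simp [Finset.mem_inf]⟩
    omega

open Polynomial in
/-- The GM-MDS theorem: there is a generator matrix of a Reed–Solomon code whose rows vanish on
prescribed sets. -/
theorem exists_isUnit_det_of_gmCondition {F : Type*} [Field F] [Fintype F] (hℓ : 0 < ℓ)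
    (h : ∀ Ω : Finset (Fin ℓ), Ω.Nonempty → (Ω.inf S).card + Ω.card ≤ ℓ)
    (hq : n + ℓ ≤ Fintype.card F + 1) :
    ∃ α : Fin n → F, Function.Injective α ∧ ∃ M : Matrix (Fin ℓ) (Fin ℓ) F, IsUnit M.det ∧
      ∀ i, ∀ j ∈ S i, ∑ e, M i e * α j ^ (e : ℕ) = 0 := by
  have hF : 1 < Fintype.card F := Fintype.one_lt_card
  have hgm := gmCondition_paddedMult (.inr (⟨0, hℓ⟩, ⟨0, hℓ⟩)) h
  have hD := hgm.det_genericCoeff_ne_zero F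
  set D := (genericCoeff F (paddedMult S)).det with hDdef
  set W := (Matrix.vandermonde fun j : Fin n =>
    (MvPolynomial.X (.inl j) : MvPolynomial (Fin n ⊕ Fin ℓ × Fin ℓ) F)).det with hWdef
  have hW : W ≠ 0 := Matrix.det_vandermonde_ne_zero_iff.2
    ((MvPolynomial.X_injective).comp Sum.inl_injective)
  have hDdeg : ∀ t, D.degreeOf t ≤ ∑ i, paddedMult S i t := by
    intro t
    refine degreeOf_det_le _ _ _ fun τ => ?_
    rw [← Equiv.sum_comp τ fun i => paddedMult S i t]
    exact Finset.sum_le_sum fun i _ => degreeOf_coeff_genericProd_le _ _ _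
  have hWdeg := fun t => degreeOf_det_vandermonde_X_le (F := F) n
    (Sum.inl : _ → Fin n ⊕ Fin ℓ × Fin ℓ) Sum.inl_injective t
  have hdeg : ∀ t, (D * W).degreeOf t < (Finset.univ : Finset F).card := by
    intro t
    rw [Finset.card_univ]
    refine ((MvPolynomial.degreeOf_mul_le _ _ _).trans
      (add_le_add (hDdeg t) (hWdeg t))).trans_lt ?_
    rcases t with j | ⟨i', e⟩
    · have h1 := card_filter_mem_lt hℓ h j
      have h2 := j.2
      simp only [paddedMult, Finset.sum_boole, Set.mem_range_self, if_true, Nat.cast_id]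
      omega
    · have : ∑ i, paddedMult S i (.inr (i', e)) ≤ 1 := by
        rw [Finset.sum_eq_single i' (fun i _ hi => by simp [paddedMult, hi.symm]) (by simp)]
        exact paddedMult_le_one _ _
      simp
      omega
  obtain ⟨x, hx⟩ : ∃ x, MvPolynomial.eval x (D * W) ≠ 0 := by
    by_contra! hcon
    exact mul_ne_zero hD hW
      (MvPolynomial.eq_zero_of_eval_zero_at_prod_finset _ _ hdeg fun x _ => hcon x)
  rw [map_mul, hDdef, hWdef, RingHom.map_det, RingHom.map_det] at hx
  refine ⟨fun j => x (.inl j), ?_,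
    (MvPolynomial.eval x).mapMatrix (genericCoeff F (paddedMult S)),
    (left_ne_zero_of_mul hx).isUnit, fun i j hj => ?_⟩
  · refine Matrix.det_vandermonde_ne_zero_iff.1 ?_
    convert right_ne_zero_of_mul hx using 2
    ext a b
    simp [Matrix.vandermonde_apply]
  · set P := (genericProd F (paddedMult S i)).map (MvPolynomial.eval x) with hP
    have hdegP : P.natDegree < ℓ := by
      refine natDegree_map_le.trans_lt ?_
      rw [natDegree_genericProd]
      have := hgm.sum_add i (Finset.mem_univ i)
      omega
    have h1 : P.eval (x (.inl j)) = 0 := by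
      rw [hP, genericProd, Polynomial.map_prod, eval_prod]
      refine Finset.prod_eq_zero (Finset.mem_univ (.inl j)) ?_
      simp [paddedMult, hj]
    rw [eval_eq_sum_range' hdegP,
      ← Fin.sum_univ_eq_sum_range (fun e => P.coeff e * x (.inl j) ^ e)] at h1
    simpa [hP, genericCoeff, coeff_map] using h1

end

section

/-- Nonzero codewords of the Reed–Solomon code of dimension `ℓ` have weight at least
`n - ℓ + 1`. -/
theorem le_hammingNorm_reedSolomon {F : Type*} [Field F] [DecidableEq F] {n ℓ : ℕ}
    {α : Fin n → F} (hα : Function.Injective α) (hln : ℓ ≤ n) {c : Fin ℓ → F} (hc : c ≠ 0) :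
    n - ℓ + 1 ≤ hammingNorm
      (Matrix.vecMul c (Matrix.of fun (a : Fin ℓ) (j : Fin n) => α j ^ (a : ℕ))) := by
  classical
  set p := Polynomial.degreeLTEquiv F ℓ |>.symm c with hp
  have hp0 : (p : Polynomial F) ≠ 0 := by
    rw [Ne, ZeroMemClass.coe_eq_zero, hp, LinearEquiv.map_eq_zero_iff]
    exact hc
  have hdeg : (p : Polynomial F).natDegree < ℓ :=
    (Polynomial.natDegree_lt_iff_degree_lt hp0).2 (Polynomial.mem_degreeLT.1 p.2)
  have heval : ∀ j, Matrix.vecMul c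
      (Matrix.of fun (a : Fin ℓ) (j : Fin n) => α j ^ (a : ℕ)) j =
      (p : Polynomial F).eval (α j) := by
    intro j
    have hcp : c = Polynomial.degreeLTEquiv F ℓ p := by rw [hp, LinearEquiv.apply_symm_apply]
    rw [Polynomial.eval_eq_sum_degreeLTEquiv p.2, hcp]
    rfl
  have hz : (Finset.univ.filter fun j => (p : Polynomial F).eval (α j) = 0).card < ℓ := by
    refine lt_of_le_of_lt ?_ hdeg
    rw [← Finset.card_image_of_injective _ hα]
    refine Polynomial.card_le_degree_of_subset_roots fun y hy => ?_
    obtain ⟨j, hj, rfl⟩ := Finset.mem_image.1 (Finset.mem_def.2 hy)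
    exact (Polynomial.mem_roots hp0).2 (Finset.mem_filter.1 hj).2
  have hadd := Finset.card_filter_add_card_filter_not (s := (Finset.univ : Finset (Fin n)))
    (fun j => (p : Polynomial F).eval (α j) = 0)
  rw [Finset.card_univ, Fintype.card_fin] at hadd
  simp only [hammingNorm, heval]
  simp only [ne_eq] at hadd ⊢
  omega

/-- If the rows indexed by `Ω` vanish on a common set, some combination of them has small
weight. -/
theorem exists_hammingNorm_vecMul_le {F : Type*} [Field F] [DecidableEq F] {k n : ℕ}
    (G : Matrix (Fin k) (Fin n) F) {Ω : Finset (Fin k)} (hΩ : Ω.Nonempty) {Z : Finset (Fin n)}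
    (hZ : ∀ i ∈ Ω, ∀ j ∈ Z, G i j = 0) (hn : Z.card + Ω.card ≤ n) :
    ∃ m : Fin k → F, m ≠ 0 ∧ hammingNorm (Matrix.vecMul m G) ≤ n - (Z.card + Ω.card) + 1 := by
  classical
  have hpos := hΩ.card_pos
  obtain ⟨E, hE, hEcard⟩ : ∃ E ⊆ Zᶜ, E.card = Ω.card - 1 :=
    Finset.exists_subset_card_eq (by rw [Finset.card_compl, Fintype.card_fin]; omega)
  have hker := LinearMap.ker_ne_bot_of_finrank_lt
    (f := Matrix.vecMulLinear (G.submatrix ((↑) : Ω → Fin k) ((↑) : E → Fin n)))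
    (by simp only [Module.finrank_fintype_fun_eq_card, Fintype.card_coe]; omega)
  obtain ⟨m, hm, hm0⟩ := (Submodule.ne_bot_iff _).1 hker
  let m' : Fin k → F := fun i => if hi : i ∈ Ω then m ⟨i, hi⟩ else 0
  have hm' : ∀ j, Matrix.vecMul m' G j = ∑ i : Ω, m i * G i j := by
    intro j
    rw [Matrix.vecMul, dotProduct, ← Finset.sum_subset (Finset.subset_univ Ω),
      ← Finset.sum_coe_sort]
    · exact Finset.sum_congr rfl fun i _ => by simp [m']
    · intro i _ hi; simp [m', hi]
  refine ⟨m', fun h0 => hm0 (funext fun i => ?_), ?_⟩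
  · simpa [m'] using congrFun h0 i
  have hsub : (Finset.univ.filter fun j => Matrix.vecMul m' G j ≠ 0) ⊆ (Z ∪ E)ᶜ := by
    intro j hj
    rw [Finset.mem_compl, Finset.mem_union]
    rintro (hjZ | hjE)
    · refine (Finset.mem_filter.1 hj).2 ?_
      rw [hm']
      exact Finset.sum_eq_zero fun i _ => by rw [hZ i i.2 j hjZ, mul_zero]
    · refine (Finset.mem_filter.1 hj).2 ?_
      rw [hm']
      exact congrFun (LinearMap.mem_ker.1 hm) ⟨j, hjE⟩
  refine (Finset.card_le_card hsub).trans ?_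
  rw [Finset.card_compl, Fintype.card_fin,
    Finset.card_union_of_disjoint (Finset.disjoint_of_subset_right hE disjoint_compl_right)]
  omega

end

/-- **Theorem 1.** Let `S_1,…,S_k ⊆ [n]`, let
`ℓ = max_{∅ ≠ Ω ⊆ [k]} (|⋂_{i∈Ω} S_i| + |Ω|)` with `ℓ ≤ n`, and let `F` be a
finite field with `|F| ≥ n + ℓ - 1` (stated as `n + ℓ ≤ |F| + 1`).  Then there
are distinct `α_1,…,α_n ∈ F` and `T ∈ F^{k×ℓ}` of rank `k` such that
`G = T ⬝ V` (with `V` the Vandermonde matrix `V i j = (α j)^i`) satisfies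
`G i j = 0` for all `j ∈ S i`, and the minimum Hamming weight of `m ⬝ G` over
nonzero `m ∈ F^k` equals `n - ℓ + 1`. -/
theorem stmt_2 {F : Type*} [Field F] [Fintype F] [DecidableEq F] {n k ℓ : ℕ}
    (hk : 1 ≤ k) (S : Fin k → Finset (Fin n))
    (hℓ : IsGreatest {x | ∃ Ω : Finset (Fin k), Ω.Nonempty ∧ x = (Ω.inf S).card + Ω.card} ℓ)
    (hln : ℓ ≤ n) (hq : n + ℓ ≤ Fintype.card F + 1) :
    ∃ α : Fin n → F, Function.Injective α ∧
      ∃ T : Matrix (Fin k) (Fin ℓ) F, T.rank = k ∧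
        (∀ i, ∀ j ∈ S i,
          (T * Matrix.of fun (a : Fin ℓ) (j : Fin n) => α j ^ (a : ℕ)) i j = 0) ∧
        IsLeast {w | ∃ m : Fin k → F, m ≠ 0 ∧ w = hammingNorm
            (Matrix.vecMul m (T * Matrix.of fun (a : Fin ℓ) (j : Fin n) => α j ^ (a : ℕ)))}
          (n - ℓ + 1) := by
  have hle : ∀ Ω : Finset (Fin k), Ω.Nonempty → (Ω.inf S).card + Ω.card ≤ ℓ :=
    fun Ω hΩ => hℓ.2 ⟨Ω, hΩ, rfl⟩
  have hkℓ : k ≤ ℓ := by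
    have := hle Finset.univ ⟨⟨0, hk⟩, Finset.mem_univ _⟩
    rw [Finset.card_univ, Fintype.card_fin] at this
    omega
  set S' : Fin ℓ → Finset (Fin n) := fun i => if hi : (i : ℕ) < k then S ⟨i, hi⟩ else ∅ with hS'
  have hle' : ∀ Ω : Finset (Fin ℓ), Ω.Nonempty → (Ω.inf S').card + Ω.card ≤ ℓ := by
    intro Ω hΩ
    by_cases hall : ∀ i ∈ Ω, (i : ℕ) < k
    · set Ω' : Finset (Fin k) := Finset.univ.filter fun i => Fin.castLE hkℓ i ∈ Ω with hΩ'
      have hmap : Ω = Ω'.map (Fin.castLEEmb hkℓ) := by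
        ext i
        simp only [hΩ', Finset.mem_map, Finset.mem_filter, Finset.mem_univ, true_and,
          Fin.castLEEmb_apply]
        constructor
        · intro hi
          exact ⟨⟨i, hall i hi⟩, hi, rfl⟩
        · rintro ⟨a, ha, rfl⟩
          exact ha
      have hne : Ω'.Nonempty := by
        rw [hmap] at hΩ
        exact Finset.map_nonempty.1 hΩ
      have hSS : S' ∘ Fin.castLEEmb hkℓ = S := by
        funext i
        simp [hS']
      rw [hmap, Finset.inf_map, Finset.card_map, hSS]
      exact hle Ω' hne
    · push Not at hall
      obtain ⟨i, hi, hik⟩ := hall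
      have h0 : Ω.inf S' = ∅ := by
        refine Finset.subset_empty.1 ((Finset.inf_le hi).trans ?_)
        simp [hS', not_lt.2 hik]
      rw [h0, Finset.card_empty, zero_add]
      simpa using Finset.card_le_univ Ω
  obtain ⟨α, hα, M, hM, hMS⟩ :=
    exists_isUnit_det_of_gmCondition (F := F) (lt_of_lt_of_le hk hkℓ) hle' hq
  have hli : LinearIndependent F (M.submatrix (Fin.castLE hkℓ) id).row :=
    ((Matrix.linearIndependent_rows_iff_isUnit.2
      ((Matrix.isUnit_iff_isUnit_det M).2 hM)).comp _ (Fin.castLE_injective hkℓ))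
  have hzero : ∀ i, ∀ j ∈ S i, (M.submatrix (Fin.castLE hkℓ) id *
      Matrix.of fun (a : Fin ℓ) (j : Fin n) => α j ^ (a : ℕ)) i j = 0 := by
    intro i j hj
    exact hMS (Fin.castLE hkℓ i) j (by simpa [hS'] using hj)
  have hlower : ∀ m : Fin k → F, m ≠ 0 → n - ℓ + 1 ≤ hammingNorm
      (Matrix.vecMul m (M.submatrix (Fin.castLE hkℓ) id *
        Matrix.of fun (a : Fin ℓ) (j : Fin n) => α j ^ (a : ℕ))) := by
    intro m hm
    rw [← Matrix.vecMul_vecMul]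
    refine le_hammingNorm_reedSolomon hα hln fun h0 => hm ?_
    exact Matrix.vecMul_injective_iff.2 hli (by simpa using h0)
  refine ⟨α, hα, M.submatrix (Fin.castLE hkℓ) id, ?_, hzero, ?_, ?_⟩
  · rw [hli.rank_matrix, Fintype.card_fin]
  · obtain ⟨Ω, hΩ, hΩℓ⟩ := hℓ.1
    obtain ⟨m, hm, hmw⟩ := exists_hammingNorm_vecMul_le _ hΩ
      (fun i hi j hj => hzero i j (Finset.mem_inf.1 hj i hi)) (hΩℓ ▸ hln)
    rw [← hΩℓ] at hmw
    exact ⟨m, hm, le_antisymm (hlower m hm) hmw⟩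
  · rintro _ ⟨m, hm, rfl⟩
    exact hlower m hm
end

section
/- Let n ≥ k ≥ 1, let S_1,…,S_k ⊆ {1,…,n}, and let q be a prime power with q ≥ n + k − 1. Then the following are equivalent: (i) for every nonempty Ω ⊆ {1,…,k}, |∩_{i∈Ω} S_i| ≤ k − |Ω|; (ii) there exist distinct elements α_1,…,α_n ∈ F_q and an invertible matrix T ∈ F_q^{k×k} such that the matrix G = T·V (where V ∈ F_q^{k×n} is the Vandermonde matrix V_{ij} = α_j^{i−1}) satisfies G_{ij} = 0 for every i ∈ {1,…,k} and j ∈ S_i. (This is the GM-MDS conjecture.) -/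
open Polynomial Matrix

/-- The polynomial `X ^ t * ∏ j ∈ S, (X - α j)`. -/
noncomputable def rootPoly {R σ : Type*} [CommRing R] (α : σ → R) (S : Finset σ) (t : ℕ) : R[X] :=
  X ^ t * ∏ j ∈ S, (X - C (α j))

section rootPoly
variable {R σ : Type*} [CommRing R] (α : σ → R) (S : Finset σ) (t : ℕ)

theorem rootPoly_monic : (rootPoly α S t).Monic :=
  (monic_X_pow t).mul (monic_prod_of_monic _ _ fun j _ => monic_X_sub_C (α j))

theorem rootPoly_natDegree [Nontrivial R] : (rootPoly α S t).natDegree = S.card + t := by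
  rw [rootPoly, (monic_X_pow t).natDegree_mul (monic_prod_of_monic _ _ fun j _ => monic_X_sub_C _),
    natDegree_prod_of_monic _ _ fun j _ => monic_X_sub_C _]
  simp [add_comm]

theorem rootPoly_degree [Nontrivial R] : (rootPoly α S t).degree = (S.card + t : ℕ) := by
  rw [degree_eq_natDegree (rootPoly_monic α S t).ne_zero, rootPoly_natDegree]

theorem rootPoly_map {R' : Type*} [CommRing R'] (f : R →+* R') :
    (rootPoly α S t).map f = rootPoly (fun j => f (α j)) S t := by
  simp [rootPoly, Polynomial.map_prod]

theorem rootPoly_succ : rootPoly α S (t + 1) = X * rootPoly α S t := by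
  rw [rootPoly, rootPoly, pow_succ']; ring

theorem rootPoly_erase [DecidableEq σ] {j : σ} (hj : j ∈ S) :
    rootPoly α S t = (X - C (α j)) * rootPoly α (S.erase j) t := by
  rw [rootPoly, rootPoly, ← Finset.mul_prod_erase S _ hj]; ring

theorem rootPoly_dvd {C : Finset σ} {u : ℕ} (hC : C ⊆ S) (hu : u ≤ t) :
    rootPoly α C u ∣ rootPoly α S t :=
  mul_dvd_mul (pow_dvd_pow _ hu) (Finset.prod_dvd_prod_of_subset _ _ _ hC)

end rootPoly

/-- The multiples of degree less than `k` of the polynomials `rootPoly α (S i) (t i)`, `i ∈ s`,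
form an independent family of subspaces. -/
def MultiplesIndep {L σ ι : Type*} [Field L] (k : ℕ) (s : Finset ι) (S : ι → Finset σ) (t : ι → ℕ)
    (α : σ → L) : Prop :=
  ∀ g : ι → L[X], (∀ i ∈ s, (g i * rootPoly α (S i) (t i)).degree < k) →
    ∑ i ∈ s, g i * rootPoly α (S i) (t i) = 0 → ∀ i ∈ s, g i = 0

theorem exists_generic_vecMul_injective {L σ m n : Type*} [Field L] [Fintype m] [DecidableEq m]
    [Fintype n] (A : Matrix m n (MvPolynomial σ L)) (α₀ : σ → L)
    (h : ∀ c : m → L, Matrix.vecMul c (A.map (MvPolynomial.eval α₀)) = 0 → c = 0) :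
    ∃ D : MvPolynomial σ L, MvPolynomial.eval α₀ D ≠ 0 ∧ ∀ α, MvPolynomial.eval α D ≠ 0 →
      ∀ c : m → L, Matrix.vecMul c (A.map (MvPolynomial.eval α)) = 0 → c = 0 := by
  classical
  obtain ⟨φ, hφ⟩ := LinearMap.exists_leftInverse_of_injective
    (Matrix.vecMulLinear (A.map (MvPolynomial.eval α₀))) (LinearMap.ker_eq_bot'.2 h)
  have key : A.map (MvPolynomial.eval α₀) * (LinearMap.toMatrix' φ)ᵀ = 1 := by
    refine Matrix.ext_of_single_vecMul fun i => ?_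
    rw [← Matrix.vecMul_vecMul, Matrix.vecMul_transpose, LinearMap.toMatrix'_mulVec,
      Matrix.vecMul_one]
    exact LinearMap.congr_fun hφ _
  let B : Matrix n m (MvPolynomial σ L) := (LinearMap.toMatrix' φ)ᵀ.map MvPolynomial.C
  have hdet (α : σ → L) : MvPolynomial.eval α (A * B).det =
      (A.map (MvPolynomial.eval α) * (LinearMap.toMatrix' φ)ᵀ).det := by
    rw [RingHom.map_det, RingHom.mapMatrix_apply, Matrix.map_mul]
    congr 2
    ext; simp [B]
  refine ⟨(A * B).det, ?_, fun α hα c hc => ?_⟩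
  · simp [hdet, key]
  · rw [hdet] at hα
    refine Matrix.eq_zero_of_vecMul_eq_zero hα ?_
    rw [← Matrix.vecMul_vecMul, hc, Matrix.zero_vecMul]

theorem degree_mul_rootPoly_lt_iff {L σ : Type*} [Field L] (α : σ → L) (S : Finset σ) (t k : ℕ)
    (g : L[X]) : (g * rootPoly α S t).degree < k ↔ g.degree < (k - (S.card + t) : ℕ) := by
  rcases eq_or_ne g 0 with rfl | hg
  · simp
  · rw [degree_mul, rootPoly_degree, degree_eq_natDegree hg, ← Nat.cast_add, Nat.cast_lt,
      Nat.cast_lt]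
    omega

/-- The coefficients of `X ^ e * rootPoly X (S i) (t i)`, the latter having generic roots. -/
noncomputable def genericCoeffMatrix (L : Type*) {σ ι : Type*} [Field L] (k : ℕ) (s : Finset ι)
    (S : ι → Finset σ) (t : ι → ℕ) :
    Matrix (Σ i : s, Fin (k - ((S i).card + t i))) (Fin k) (MvPolynomial σ L) :=
  fun p a => (X ^ (p.2 : ℕ) * rootPoly MvPolynomial.X (S p.1) (t p.1)).coeff a

theorem eq_sum_fin_of_degree_lt {R : Type*} [Semiring R] {g : R[X]} {d : ℕ}
    (hg : g.degree < d) : g = ∑ e : Fin d, C (g.coeff e) * X ^ (e : ℕ) := by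
  ext a
  rw [finsetSum_coeff]
  simp only [coeff_C_mul_X_pow]
  by_cases ha : a < d
  · rw [Finset.sum_eq_single ⟨a, ha⟩] <;> simp +contextual [Fin.ext_iff, eq_comm]
  · rw [coeff_eq_zero_of_degree_lt (hg.trans_le (Nat.cast_le.2 (not_lt.1 ha))),
      Finset.sum_eq_zero]
    intro e _
    rw [if_neg (by omega)]

theorem vecMul_genericCoeffMatrix {L σ ι : Type*} [Field L] (k : ℕ) (s : Finset ι)
    (S : ι → Finset σ) (t : ι → ℕ) (α : σ → L) (g : ι → L[X])
    (hg : ∀ i ∈ s, (g i).degree < (k - ((S i).card + t i) : ℕ)) (a : Fin k) :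
    Matrix.vecMul (fun p : Σ i : s, Fin (k - ((S i).card + t i)) => (g p.1).coeff p.2)
      ((genericCoeffMatrix L k s S t).map (MvPolynomial.eval α)) a =
    (∑ i ∈ s, g i * rootPoly α (S i) (t i)).coeff a := by
  have hmap (p : Σ i : s, Fin (k - ((S i).card + t i))) :
      MvPolynomial.eval α (genericCoeffMatrix L k s S t p a) =
        (X ^ (p.2 : ℕ) * rootPoly α (S p.1) (t p.1)).coeff a := by
    rw [genericCoeffMatrix, ← coeff_map, Polynomial.map_mul, rootPoly_map]
    simp
  simp only [Matrix.vecMul, dotProduct, Matrix.map_apply, hmap, Fintype.sum_sigma,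
    finsetSum_coeff]
  rw [← Finset.sum_coe_sort s]
  refine Finset.sum_congr rfl fun i _ => ?_
  conv_rhs => rw [eq_sum_fin_of_degree_lt (hg i i.2), Finset.sum_mul, finsetSum_coeff]
  exact Finset.sum_congr rfl fun e _ => by rw [mul_assoc, coeff_C_mul]

theorem multiplesIndep_iff {L σ ι : Type*} [Field L] (k : ℕ) (s : Finset ι)
    (S : ι → Finset σ) (t : ι → ℕ) (α : σ → L) :
    MultiplesIndep k s S t α ↔ ∀ c : (Σ i : s, Fin (k - ((S i).card + t i))) → L,
      Matrix.vecMul c ((genericCoeffMatrix L k s S t).map (MvPolynomial.eval α)) = 0 → c = 0 := by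
  classical
  simp only [MultiplesIndep, degree_mul_rootPoly_lt_iff]
  constructor
  · intro h c hc
    let g : ι → L[X] := fun i =>
      if hi : i ∈ s then ∑ e, C (c ⟨⟨i, hi⟩, e⟩) * X ^ (e : ℕ) else 0
    have hg : ∀ i ∈ s, (g i).degree < (k - ((S i).card + t i) : ℕ) := by
      intro i hi
      simp only [g, dif_pos hi]
      exact degree_sum_fin_lt _
    have hcoeff : (fun p : Σ i : s, Fin (k - ((S i).card + t i)) => (g p.1).coeff p.2) = c := by
      ext ⟨⟨i, hi⟩, e⟩
      simp only [g, dif_pos hi, finsetSum_coeff, coeff_C_mul_X_pow]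
      rw [Finset.sum_eq_single e] <;> simp +contextual [Fin.ext_iff, eq_comm]
    have hzero : ∑ i ∈ s, g i * rootPoly α (S i) (t i) = 0 := by
      ext a
      by_cases ha : a < k
      · rw [← vecMul_genericCoeffMatrix k s S t α g hg ⟨a, ha⟩, hcoeff, hc]
        simp
      · rw [coeff_zero]
        refine coeff_eq_zero_of_degree_lt (lt_of_lt_of_le ?_ (Nat.cast_le.2 (not_lt.1 ha)))
        exact mem_degreeLT.1 <| Submodule.sum_mem _ fun i hi =>
          mem_degreeLT.2 <| (degree_mul_rootPoly_lt_iff _ _ _ _ _).2 (hg i hi)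
    rw [← hcoeff]
    ext p
    simp [h g hg hzero p.1 p.1.2]
  · intro h g hg hsum i hi
    have := h (fun p => (g p.1).coeff p.2) (by
      ext a
      rw [vecMul_genericCoeffMatrix k s S t α g hg a, hsum]
      simp)
    ext e
    by_cases he : e < k - ((S i).card + t i)
    · simpa using congrFun this ⟨⟨i, hi⟩, ⟨e, he⟩⟩
    · exact coeff_eq_zero_of_degree_lt ((hg i hi).trans_le (Nat.cast_le.2 (not_lt.1 he)))

theorem MultiplesIndep.exists_generic {L σ ι : Type*} [Field L] {k : ℕ} {s : Finset ι}
    {S : ι → Finset σ} {t : ι → ℕ} {α₀ : σ → L} (h : MultiplesIndep k s S t α₀) :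
    ∃ D : MvPolynomial σ L, D ≠ 0 ∧ ∀ α, MvPolynomial.eval α D ≠ 0 →
      MultiplesIndep k s S t α := by
  classical
  obtain ⟨D, hD, hD'⟩ := exists_generic_vecMul_injective (genericCoeffMatrix L k s S t) α₀
    ((multiplesIndep_iff k s S t α₀).1 h)
  exact ⟨D, fun h0 => hD (by simp [h0]), fun α hα => (multiplesIndep_iff k s S t α).2 (hD' α hα)⟩

namespace MultiplesIndep

variable {L σ ι : Type*} [Field L] {k : ℕ} {s : Finset ι} {S : ι → Finset σ} {t : ι → ℕ}
  {α : σ → L}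

theorem of_erase [DecidableEq ι] {m : ι} (hm : m ∈ s) (hk : k ≤ (S m).card + t m)
    (h : MultiplesIndep k (s.erase m) S t α) : MultiplesIndep k s S t α := by
  intro g hg hsum
  have hgm : g m = 0 := by
    have := (degree_mul_rootPoly_lt_iff _ _ _ _ _).1 (hg m hm)
    rwa [Nat.sub_eq_zero_of_le hk, Nat.cast_zero, Nat.WithBot.lt_zero_iff, degree_eq_bot] at this
  rw [← Finset.add_sum_erase _ _ hm, hgm, zero_mul, zero_add] at hsum
  intro i hi
  by_cases him : i = m
  · rw [him, hgm]
  · exact h g (fun i hi => hg i (Finset.mem_of_mem_erase hi)) hsum i (Finset.mem_erase.2 ⟨him, hi⟩)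

theorem of_subfamily [DecidableEq ι] {I : Finset ι} {i₀ : ι} {D : Finset σ} {u : ℕ} (hI : I ⊆ s)
    (hi₀ : i₀ ∈ I) (hD : ∀ i ∈ I, D ⊆ S i ∧ u ≤ t i) (h₁ : MultiplesIndep k I S t α)
    (h₂ : MultiplesIndep k (insert i₀ (s \ I)) (Function.update S i₀ D)
      (Function.update t i₀ u) α) :
    MultiplesIndep k s S t α := by
  intro g hg hsum
  obtain ⟨f, hf⟩ : rootPoly α D u ∣ ∑ i ∈ I, g i * rootPoly α (S i) (t i) :=
    Finset.dvd_sum fun i hi => ((rootPoly_dvd α _ _ (hD i hi).1 (hD i hi).2).mul_left _)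
  have hne {i : ι} (hi : i ∈ s \ I) : i ≠ i₀ := by
    rintro rfl
    exact (Finset.mem_sdiff.1 hi).2 hi₀
  have hnot : i₀ ∉ s \ I := fun hi => hne hi rfl
  have hdeg : (∑ i ∈ I, g i * rootPoly α (S i) (t i)).degree < k :=
    mem_degreeLT.1 <| Submodule.sum_mem _ fun i hi => mem_degreeLT.2 (hg i (hI hi))
  have h0 := h₂ (Function.update g i₀ f) (by
    intro i hi
    rcases Finset.mem_insert.1 hi with rfl | hi
    · simpa [mul_comm f, ← hf] using hdeg
    · simpa [hne hi] using hg i (Finset.mem_sdiff.1 hi).1) (by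
    rw [Finset.sum_insert hnot]
    simp only [Function.update_self]
    rw [mul_comm, ← hf, ← hsum, ← Finset.sum_sdiff hI, add_comm]
    congr 1
    exact Finset.sum_congr rfl fun i hi => by simp [hne hi])
  intro i hi
  by_cases hiI : i ∈ I
  · refine h₁ g (fun i hi => hg i (hI hi)) ?_ i hiI
    have := h0 i₀ (Finset.mem_insert_self _ _)
    rw [Function.update_self] at this
    rw [hf, this, mul_zero]
  · have hi' := Finset.mem_sdiff.2 ⟨hi, hiI⟩
    simpa [hne hi'] using h0 i (Finset.mem_insert_of_mem hi')

theorem of_factor {S' : ι → Finset σ} {t' : ι → ℕ} {a : L}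
    (hfac : ∀ i ∈ s, rootPoly α (S i) (t i) = (X - C a) * rootPoly α (S' i) (t' i))
    (h : MultiplesIndep k s S' t' α) : MultiplesIndep (k + 1) s S t α := by
  intro g hg hsum
  refine h g (fun i hi => ?_) ?_
  · have := hg i hi
    rw [hfac i hi, mul_left_comm, degree_mul, degree_X_sub_C, add_comm, Nat.cast_succ] at this
    exact lt_of_add_lt_add_right this
  · refine (mul_eq_zero.1 ?_).resolve_left (X_sub_C_ne_zero a)
    rw [← hsum, Finset.mul_sum]
    exact Finset.sum_congr rfl fun i hi => by rw [hfac i hi]; ring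

theorem of_update_zero [DecidableEq σ] (j : σ)
    (h : MultiplesIndep k s (fun i => (S i).erase j) (fun i => t i + if j ∈ S i then 1 else 0) α) :
    MultiplesIndep k s S t (Function.update α j 0) := by
  have key (i : ι) : rootPoly (Function.update α j 0) (S i) (t i) =
      rootPoly α ((S i).erase j) (t i + if j ∈ S i then 1 else 0) := by
    have h0 : rootPoly (Function.update α j 0) ((S i).erase j) (t i) =
        rootPoly α ((S i).erase j) (t i) := by
      rw [rootPoly, rootPoly]
      congr 1
      exact Finset.prod_congr rfl fun l hl => by simp [(Finset.mem_erase.1 hl).1]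
    split_ifs with hj
    · rw [rootPoly_succ, rootPoly_erase _ _ _ hj, h0]
      simp
    · rw [add_zero, ← h0, Finset.erase_eq_of_notMem hj]
  simpa only [MultiplesIndep, key] using h

theorem of_unique_ne_zero [DecidableEq ι] {m : ι} (hm : m ∈ s) (htm : t m = 0)
    (ht : ∀ i ∈ s, i ≠ m → 1 ≤ t i) (hα : ∀ j ∈ S m, α j ≠ 0)
    (h : MultiplesIndep k s S (fun i => t i - 1) α) : MultiplesIndep (k + 1) s S t α := by
  intro g hg hsum
  have hfac {i : ι} (hi : i ∈ s) (him : i ≠ m) :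
      rootPoly α (S i) (t i) = X * rootPoly α (S i) (t i - 1) := by
    rw [← rootPoly_succ, Nat.sub_add_cancel (ht i hi him)]
  obtain ⟨f, hf⟩ : X ∣ g m := by
    have h0 := congrArg (eval 0) hsum
    rw [← Finset.add_sum_erase _ _ hm, eval_add, eval_finsetSum, Finset.sum_eq_zero, add_zero,
      eval_mul, eval_zero] at h0
    · rw [X_dvd_iff, coeff_zero_eq_eval_zero]
      refine (mul_eq_zero.1 h0).resolve_right ?_
      simpa [rootPoly, htm, eval_prod, Finset.prod_eq_zero_iff] using hα
    · intro i hi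
      rw [hfac (Finset.mem_of_mem_erase hi) (Finset.ne_of_mem_erase hi)]
      simp
  have hmul {i : ι} (hi : i ∈ s) : g i * rootPoly α (S i) (t i) =
      X * (Function.update g m f i * rootPoly α (S i) (t i - 1)) := by
    by_cases him : i = m
    · subst him
      rw [Function.update_self, hf, htm]
      ring
    · rw [Function.update_of_ne him, hfac hi him]
      ring
  have h0 := h (Function.update g m f) (fun i hi => ?_) ?_
  · intro i hi
    have := h0 i hi
    by_cases him : i = m
    · subst him
      rw [Function.update_self] at this
      rw [hf, this, mul_zero]
    · rwa [Function.update_of_ne him] at this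
  · have := hg i hi
    rw [hmul hi, degree_mul, degree_X, add_comm, Nat.cast_succ] at this
    exact lt_of_add_lt_add_right this
  · refine (mul_eq_zero.1 ?_).resolve_left X_ne_zero
    rw [← hsum, Finset.mul_sum]
    exact Finset.sum_congr rfl fun i hi => (hmul hi).symm

end MultiplesIndep

/-- The combinatorial condition on the exponents under which the multiples of
`rootPoly α (S i) (t i)` are independent for a suitable `α`. -/
def SupportCondition {σ ι : Type*} (k : ℕ) (s : Finset ι) (S : ι → Finset σ) (t : ι → ℕ) : Prop :=
  ∀ I ⊆ s, I.Nonempty → ∀ (D : Finset σ) (u : ℕ), (∀ i ∈ I, D ⊆ S i ∧ u ≤ t i) →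
    ∑ i ∈ I, (k - ((S i).card + t i)) + (D.card + u) ≤ k

namespace SupportCondition

variable {σ ι : Type*} {k : ℕ} {s : Finset ι} {S : ι → Finset σ} {t : ι → ℕ}

theorem mono {s' : Finset ι} (h : SupportCondition k s S t) (hs : s' ⊆ s) :
    SupportCondition k s' S t :=
  fun I hI => h I (hI.trans hs)

theorem card_add_le (h : SupportCondition k s S t) {i : ι} (hi : i ∈ s) :
    (S i).card + t i ≤ k := by
  have := h {i} (by simpa using hi) (by simp) (S i) (t i) (by simp)
  omega

theorem subfamily [DecidableEq ι] {I : Finset ι} {i₀ : ι} {D : Finset σ} {u : ℕ}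
    (h : SupportCondition k s S t) (hI : I ⊆ s) (hi₀ : i₀ ∈ I)
    (hD : ∀ i ∈ I, D ⊆ S i ∧ u ≤ t i)
    (htight : k ≤ ∑ i ∈ I, (k - ((S i).card + t i)) + (D.card + u)) :
    SupportCondition k (insert i₀ (s \ I)) (Function.update S i₀ D) (Function.update t i₀ u) := by
  have hne {i : ι} (hi : i ∈ s \ I) : i ≠ i₀ := by
    rintro rfl
    exact (Finset.mem_sdiff.1 hi).2 hi₀
  intro J hJ hJne D' u' hD'
  have hJ' : J.erase i₀ ⊆ s \ I := by rwa [← Finset.subset_insert_iff]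
  have hsum : ∑ i ∈ J.erase i₀, (k - ((Function.update S i₀ D i).card +
      Function.update t i₀ u i)) = ∑ i ∈ J.erase i₀, (k - ((S i).card + t i)) :=
    Finset.sum_congr rfl fun i hi => by
      simp [Function.update_of_ne (hne (hJ' hi))]
  have hD'' : ∀ i ∈ J.erase i₀, D' ⊆ S i ∧ u' ≤ t i := fun i hi => by
    simpa [Function.update_of_ne (hne (hJ' hi))] using hD' i (Finset.mem_of_mem_erase hi)
  by_cases hmem : i₀ ∈ J
  · have hD0 : D' ⊆ D ∧ u' ≤ u := by simpa using hD' i₀ hmem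
    have hdisj : Disjoint I (J.erase i₀) :=
      Finset.disjoint_left.2 fun i hi hi' => (Finset.mem_sdiff.1 (hJ' hi')).2 hi
    have := h (I ∪ J.erase i₀)
      (Finset.union_subset hI (hJ'.trans Finset.sdiff_subset))
      ⟨i₀, Finset.mem_union_left _ hi₀⟩ D' u' (by
        intro i hi
        rcases Finset.mem_union.1 hi with hi | hi
        · exact ⟨hD0.1.trans (hD i hi).1, hD0.2.trans (hD i hi).2⟩
        · exact hD'' i hi)
    rw [Finset.sum_union hdisj] at this
    rw [← Finset.add_sum_erase _ _ hmem, hsum, Function.update_self, Function.update_self]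
    omega
  · rw [Finset.erase_eq_of_notMem hmem] at hsum hD'' hJ'
    rw [hsum]
    exact h J (hJ'.trans Finset.sdiff_subset) hJne D' u' hD''

theorem erase_common [DecidableEq σ] {j : σ} (h : SupportCondition (k + 1) s S t)
    (hj : ∀ i ∈ s, j ∈ S i) : SupportCondition k s (fun i => (S i).erase j) t := by
  intro I hI hIne D u hD
  dsimp only at hD ⊢
  have hjD : j ∉ D := fun hjD => by
    obtain ⟨i, hi⟩ := hIne
    simpa using (hD i hi).1 hjD
  have := h I hI hIne (insert j D) u fun i hi =>
    ⟨Finset.insert_subset (hj i (hI hi)) ((hD i hi).1.trans (Finset.erase_subset _ _)), (hD i hi).2⟩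
  rw [Finset.card_insert_of_notMem hjD] at this
  have hsum : ∑ i ∈ I, (k - (((S i).erase j).card + t i)) =
      ∑ i ∈ I, (k + 1 - ((S i).card + t i)) :=
    Finset.sum_congr rfl fun i hi => by
      have := Finset.card_erase_add_one (hj i (hI hi))
      omega
  omega

theorem sub_one_common (h : SupportCondition (k + 1) s S t) (ht : ∀ i ∈ s, 1 ≤ t i) :
    SupportCondition k s S (fun i => t i - 1) := by
  intro I hI hIne D u hD
  dsimp only at hD ⊢
  have := h I hI hIne D (u + 1) fun i hi =>
    ⟨(hD i hi).1, by have := (hD i hi).2; have := ht i (hI hi); omega⟩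
  have hsum : ∑ i ∈ I, (k - ((S i).card + (t i - 1))) =
      ∑ i ∈ I, (k + 1 - ((S i).card + t i)) :=
    Finset.sum_congr rfl fun i hi => by
      have := ht i (hI hi)
      omega
  omega

theorem sub_one_of_unique [DecidableEq ι] {m : ι} (h : SupportCondition (k + 1) s S t)
    (htm : t m = 0) (hSm : (S m).card ≤ k) (ht : ∀ i ∈ s, i ≠ m → 1 ≤ t i) :
    SupportCondition k s S (fun i => t i - 1) := by
  intro I hI hIne D u hD
  dsimp only at hD ⊢
  by_cases hmI : m ∈ I
  · have hu : u = 0 := by simpa [htm] using (hD m hmI).2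
    have := h I hI hIne D 0 fun i hi => ⟨(hD i hi).1, Nat.zero_le _⟩
    rw [← Finset.add_sum_erase _ _ hmI] at this ⊢
    have hsum : ∑ i ∈ I.erase m, (k - ((S i).card + (t i - 1))) =
        ∑ i ∈ I.erase m, (k + 1 - ((S i).card + t i)) :=
      Finset.sum_congr rfl fun i hi => by
        have := ht i (hI (Finset.mem_of_mem_erase hi)) (Finset.ne_of_mem_erase hi)
        omega
    rw [hsum, htm]
    rw [htm] at this
    omega
  · exact (h.mono hI).sub_one_common
      (fun i hi => ht i (hI hi) fun him => hmI (him ▸ hi)) I subset_rfl hIne D u hD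

theorem erase_add [DecidableEq σ] {j : σ} (h : SupportCondition k s S t)
    (hloose : ∀ I ⊆ s, I ≠ s → 1 < I.card → ∀ (D : Finset σ) (u : ℕ),
      (∀ i ∈ I, D ⊆ S i ∧ u ≤ t i) → ∑ i ∈ I, (k - ((S i).card + t i)) + (D.card + u) < k)
    (hcommon : ∀ l, ∃ i ∈ s, l ∉ S i) (ht : ∃ i ∈ s, t i = 0) (hj : ∃ i ∈ s, j ∉ S i ∧ t i = 0) :
    SupportCondition k s (fun i => (S i).erase j) (fun i => t i + if j ∈ S i then 1 else 0) := by
  intro I hI hIne D u hD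
  dsimp only at hD ⊢
  have hcard (i : ι) : ((S i).erase j).card + (t i + if j ∈ S i then 1 else 0) =
      (S i).card + t i := by
    split_ifs with hji
    · have := Finset.card_erase_add_one hji
      omega
    · rw [Finset.erase_eq_of_notMem hji, add_zero]
  simp only [hcard]
  have hDS : ∀ i ∈ I, D ⊆ S i ∧ u - 1 ≤ t i := fun i hi => by
    refine ⟨(hD i hi).1.trans (Finset.erase_subset _ _), ?_⟩
    have := (hD i hi).2
    split_ifs at this <;> omega
  rcases Nat.eq_zero_or_pos u with hu | hu
  · simpa [hu] using h I hI hIne D (u - 1) hDS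
  by_cases hIs : I = s
  · subst hIs
    have hu1 : u - 1 = 0 := by
      obtain ⟨i, hi, hti⟩ := ht
      have := (hDS i hi).2
      omega
    obtain ⟨i, hi, hji, hti⟩ := hj
    have := (hD i hi).2
    simp [hji, hti] at this
    omega
  rcases Nat.lt_or_ge 1 I.card with hI1 | hI1
  · have := hloose I hI hIs hI1 D (u - 1) hDS
    omega
  · obtain ⟨i, rfl⟩ := Finset.card_eq_one.1 (le_antisymm hI1 hIne.card_pos)
    have h1 := Finset.card_le_card (hD i (by simp)).1
    have h2 := (hD i (by simp)).2
    have h3 := hcard i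
    have h4 := h.card_add_le (hI (Finset.mem_singleton_self i))
    rw [Finset.sum_singleton]
    omega

end SupportCondition

theorem MvPolynomial.exists_eval_ne_zero {L σ : Type*} [Field L] [Infinite L]
    {D : MvPolynomial σ L} (hD : D ≠ 0) : ∃ α, MvPolynomial.eval α D ≠ 0 := by
  by_contra! h
  exact hD (MvPolynomial.funext fun x => by simp [h])

theorem SupportCondition.exists_multiplesIndep {L σ ι : Type*} [Field L] [Infinite L] {k : ℕ}
    {s : Finset ι} {N : Finset σ} {S : ι → Finset σ} {t : ι → ℕ}
    (h : SupportCondition k s S t) (hN : ∀ i ∈ s, S i ⊆ N) :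
    ∃ α : σ → L, MultiplesIndep k s S t α := by
  classical
  induction hc : k + N.card + s.card using Nat.strong_induction_on generalizing k s N S t with
  | _ c ih =>
  subst hc
  rcases s.eq_empty_or_nonempty with rfl | hs
  · exact ⟨fun _ => 0, fun _ _ _ i hi => by simp at hi⟩
  by_cases hfull : ∃ m ∈ s, k ≤ (S m).card + t m
  · obtain ⟨m, hm, hkm⟩ := hfull
    have := Finset.card_erase_lt_of_mem hm
    obtain ⟨α, hα⟩ := ih _ (by omega) (h.mono (Finset.erase_subset m s))
      (fun i hi => hN i (Finset.mem_of_mem_erase hi)) rfl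
    exact ⟨α, hα.of_erase hm hkm⟩
  push Not at hfull
  by_cases htight : ∃ I ⊆ s, I ≠ s ∧ 1 < I.card ∧ ∃ (D : Finset σ) (u : ℕ),
      (∀ i ∈ I, D ⊆ S i ∧ u ≤ t i) ∧ k ≤ ∑ i ∈ I, (k - ((S i).card + t i)) + (D.card + u)
  · obtain ⟨I, hI, hIs, hI1, D, u, hD, htight⟩ := htight
    obtain ⟨i₀, hi₀⟩ : I.Nonempty := Finset.card_pos.1 (by omega)
    have hlt : I.card < s.card := Finset.card_lt_card (hI.ssubset_of_ne hIs)
    have hlt' : (insert i₀ (s \ I)).card < s.card := by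
      have := Finset.card_sdiff_add_card_eq_card hI
      have := Finset.card_insert_le i₀ (s \ I)
      omega
    obtain ⟨α₁, hα₁⟩ := ih _ (by omega) (h.mono hI) (fun i hi => hN i (hI hi)) rfl
    obtain ⟨α₂, hα₂⟩ := ih _ (by omega) (h.subfamily hI hi₀ hD htight) (N := N) (by
      intro i hi
      by_cases hii : i = i₀
      · rw [hii, Function.update_self]
        exact (hD i₀ hi₀).1.trans (hN i₀ (hI hi₀))
      · rw [Function.update_of_ne hii]
        exact hN i (by simpa [hii] using hi : i ∈ s ∧ i ∉ I).1) rfl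
    obtain ⟨D₁, hD₁, hgen₁⟩ := hα₁.exists_generic
    obtain ⟨D₂, hD₂, hgen₂⟩ := hα₂.exists_generic
    obtain ⟨α, hα⟩ := MvPolynomial.exists_eval_ne_zero (mul_ne_zero hD₁ hD₂)
    rw [map_mul, mul_ne_zero_iff] at hα
    exact ⟨α, .of_subfamily hI hi₀ hD (hgen₁ α hα.1) (hgen₂ α hα.2)⟩
  push Not at htight
  obtain ⟨k, rfl⟩ : ∃ l, k = l + 1 := by
    obtain ⟨i, hi⟩ := hs
    exact Nat.exists_eq_add_one.2 (by have := hfull i hi; omega)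
  by_cases hcommon : ∃ j, ∀ i ∈ s, j ∈ S i
  · obtain ⟨j, hj⟩ := hcommon
    obtain ⟨α, hα⟩ := ih _ (by omega) (h.erase_common hj)
      (fun i hi => (Finset.erase_subset _ _).trans (hN i hi)) rfl
    exact ⟨α, hα.of_factor fun i hi => rootPoly_erase _ _ _ (hj i hi)⟩
  push Not at hcommon
  by_cases hpos : ∀ i ∈ s, 1 ≤ t i
  · obtain ⟨α, hα⟩ := ih _ (by omega) (h.sub_one_common hpos) hN rfl
    refine ⟨α, hα.of_factor (a := 0) fun i hi => ?_⟩
    rw [C_0, sub_zero, ← rootPoly_succ, Nat.sub_add_cancel (hpos i hi)]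
  obtain ⟨m, hm, htm⟩ : ∃ i ∈ s, t i = 0 := by
    push Not at hpos
    obtain ⟨i, hi, hti⟩ := hpos
    exact ⟨i, hi, by omega⟩
  by_cases hmerge : ∃ j ∈ N, ∃ i ∈ s, j ∉ S i ∧ t i = 0
  · obtain ⟨j, hjN, hj⟩ := hmerge
    have := Finset.card_erase_lt_of_mem hjN
    obtain ⟨α, hα⟩ := ih _ (by omega) (h.erase_add htight hcommon ⟨m, hm, htm⟩ hj)
      (N := N.erase j) (fun i hi => Finset.erase_subset_erase _ (hN i hi)) rfl
    exact ⟨_, hα.of_update_zero j⟩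
  push Not at hmerge
  have hSN {i : ι} (hi : i ∈ s) (hti : t i = 0) : S i = N := by
    refine (hN i hi).antisymm fun j hj => ?_
    by_contra hji
    exact hmerge j hj i hi hji hti
  have hunique : ∀ i ∈ s, i ≠ m → 1 ≤ t i := by
    intro i hi him
    by_contra hti
    have hti : t i = 0 := by omega
    have := h {i, m} (by simp [Finset.insert_subset_iff, hi, hm]) (by simp) N 0
      (by simp [hSN hi hti, hSN hm htm])
    rw [Finset.sum_pair him, hSN hi hti, hSN hm htm, hti, htm] at this
    have := hfull m hm
    rw [hSN hm htm, htm] at this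
    omega
  obtain ⟨α₀, hα₀⟩ := ih _ (by omega) (h.sub_one_of_unique htm
    (by have := hfull m hm; omega) hunique) hN rfl
  obtain ⟨D, hD, hgen⟩ := hα₀.exists_generic
  obtain ⟨α, hα⟩ := MvPolynomial.exists_eval_ne_zero (mul_ne_zero hD
    (Finset.prod_ne_zero_iff.2 fun j (_ : j ∈ S m) => MvPolynomial.X_ne_zero (R := L) j))
  rw [map_mul, mul_ne_zero_iff, map_prod, Finset.prod_ne_zero_iff] at hα
  exact ⟨α, (hgen α hα.1).of_unique_ne_zero hm htm hunique (by simpa using hα.2)⟩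

/-- If the `r`-fold intersections of the `S i` have at most `k - r` elements, any `S i` with fewer
than `k - 1` elements can be enlarged by one element without losing this property. -/
theorem exists_insert_inf_card_add_le {n k : ℕ} (hkn : k ≤ n) (S : Fin k → Finset (Fin n))
    (hS : ∀ Ω : Finset (Fin k), Ω.Nonempty → (Ω.inf S).card + Ω.card ≤ k) (i : Fin k)
    (hi : (S i).card + 1 < k) : ∃ a ∉ S i, ∀ Ω : Finset (Fin k), Ω.Nonempty →
      (Ω.inf (Function.update S i (insert a (S i)))).card + Ω.card ≤ k := by
  have hinf (Ω : Finset (Fin k)) (a : Fin n) : Ω.inf (Function.update S i (insert a (S i))) =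
      if i ∈ Ω then insert a (S i) ∩ (Ω.erase i).inf S else Ω.inf S := by
    split_ifs with hiΩ
    · nth_rw 1 [← Finset.insert_erase hiΩ]
      rw [Finset.inf_insert, Function.update_self]
      congr 1
      exact Finset.inf_congr rfl fun j hj => Function.update_of_ne (Finset.ne_of_mem_erase hj) _ _
    · exact Finset.inf_congr rfl fun j hj => Function.update_of_ne (by rintro rfl; exact hiΩ hj) _ _
  have hcompl : 1 < (S i)ᶜ.card := by
    rw [Finset.card_compl, Fintype.card_fin]
    omega
  obtain ⟨a, ha, b, hb, hab⟩ := Finset.one_lt_card.1 hcompl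
  rw [Finset.mem_compl] at ha hb
  have hviol {a : Fin n} (ha : ¬ ∀ Ω : Finset (Fin k), Ω.Nonempty →
      (Ω.inf (Function.update S i (insert a (S i)))).card + Ω.card ≤ k) :
      ∃ Ω : Finset (Fin k), i ∉ Ω ∧ k ≤ (insert a (S i) ∩ Ω.inf S).card + Ω.card := by
    push Not at ha
    obtain ⟨Ω, hΩ, hlt⟩ := ha
    rw [hinf] at hlt
    split_ifs at hlt with hiΩ
    · refine ⟨Ω.erase i, Finset.notMem_erase _ _, ?_⟩
      have := Finset.card_erase_add_one hiΩ
      omega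
    · have := hS Ω hΩ
      omega
  by_contra! hcon
  obtain ⟨Ω₁, hi₁, h₁⟩ := hviol (a := a) (by push Not; exact hcon a ha)
  obtain ⟨Ω₂, hi₂, h₂⟩ := hviol (a := b) (by push Not; exact hcon b hb)
  have hadd := Finset.card_union_add_card_inter (insert a (S i) ∩ Ω₁.inf S)
    (insert b (S i) ∩ Ω₂.inf S)
  have hΩ := Finset.card_union_add_card_inter Ω₁ Ω₂
  have hinter : ((insert a (S i) ∩ Ω₁.inf S) ∩ (insert b (S i) ∩ Ω₂.inf S)).card +
      ((Ω₁ ∪ Ω₂).card + 1) ≤ k := by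
    rw [← Finset.card_insert_of_notMem (a := i) (s := Ω₁ ∪ Ω₂) (by simp [hi₁, hi₂])]
    refine le_trans (Nat.add_le_add_right (Finset.card_le_card ?_) _)
      (hS _ (Finset.insert_nonempty _ _))
    rw [Finset.inf_insert, Finset.inf_union]
    intro x hx
    simp only [Finset.mem_inter, Finset.mem_insert, Finset.inf_eq_inter] at hx ⊢
    grind
  have hunion : ((insert a (S i) ∩ Ω₁.inf S) ∪ (insert b (S i) ∩ Ω₂.inf S)).card +
      (Ω₁ ∩ Ω₂).card ≤ k := by
    rcases (Ω₁ ∩ Ω₂).eq_empty_or_nonempty with h0 | h0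
    · rw [h0, Finset.card_empty]
      have := Finset.card_le_card (show (insert a (S i) ∩ Ω₁.inf S) ∪ (insert b (S i) ∩ Ω₂.inf S) ⊆
        insert a (insert b (S i)) by
          intro x hx
          simp only [Finset.mem_union, Finset.mem_inter, Finset.mem_insert] at hx ⊢
          tauto)
      have := Finset.card_insert_le a (insert b (S i))
      have := Finset.card_insert_le b (S i)
      omega
    · refine le_trans (Nat.add_le_add_right (Finset.card_le_card ?_) _) (hS _ h0)
      exact Finset.union_subset
        (Finset.inter_subset_right.trans (Finset.inf_mono Finset.inter_subset_left))
        (Finset.inter_subset_right.trans (Finset.inf_mono Finset.inter_subset_right))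
  omega

theorem exists_superset_card_eq_of_inf_card_add_le {n k : ℕ} (hkn : k ≤ n)
    (S : Fin k → Finset (Fin n))
    (hS : ∀ Ω : Finset (Fin k), Ω.Nonempty → (Ω.inf S).card + Ω.card ≤ k) :
    ∃ S' : Fin k → Finset (Fin n), (∀ i, S i ⊆ S' i) ∧ (∀ i, (S' i).card + 1 = k) ∧
      ∀ Ω : Finset (Fin k), Ω.Nonempty → (Ω.inf S').card + Ω.card ≤ k := by
  induction hd : ∑ i, (k - (S i).card) using Nat.strong_induction_on generalizing S with
  | _ d ih =>
  subst hd
  by_cases hfull : ∃ i, (S i).card + 1 < k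
  · obtain ⟨i, hi⟩ := hfull
    obtain ⟨a, ha, hSa⟩ := exists_insert_inf_card_add_le hkn S hS i hi
    have hle (j : Fin k) : S j ⊆ Function.update S i (insert a (S i)) j := by
      rcases eq_or_ne j i with rfl | hj
      · simp
      · simp [hj]
    obtain ⟨S', hsub, hcard, hS'⟩ := ih _ (Finset.sum_lt_sum
      (fun j _ => Nat.sub_le_sub_left (Finset.card_le_card (hle j)) k)
      ⟨i, Finset.mem_univ i, by
        rw [Function.update_self, Finset.card_insert_of_notMem ha]
        omega⟩) _ hSa rfl
    exact ⟨S', fun j => (hle j).trans (hsub j), hcard, hS'⟩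
  · push Not at hfull
    refine ⟨S, fun i => subset_rfl, fun i => le_antisymm ?_ (hfull i), hS⟩
    simpa using hS {i} (by simp)

theorem supportCondition_of_inf_card_add_le {n k : ℕ} (S : Fin k → Finset (Fin n))
    (hcard : ∀ i, (S i).card + 1 = k)
    (hS : ∀ Ω : Finset (Fin k), Ω.Nonempty → (Ω.inf S).card + Ω.card ≤ k) :
    SupportCondition k Finset.univ S fun _ => 0 := by
  intro I _ hI D u hD
  have hu : u = 0 := by
    obtain ⟨i, hi⟩ := hI
    simpa using (hD i hi).2
  have hsum : ∑ i ∈ I, (k - ((S i).card + 0)) = I.card := by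
    rw [Finset.card_eq_sum_ones]
    exact Finset.sum_congr rfl fun i _ => by have := hcard i; omega
  rw [hsum, hu]
  have := hS I hI
  have := Finset.card_le_card (show D ⊆ I.inf S from Finset.le_inf fun i hi => (hD i hi).1)
  omega

/-- The matrix whose `i`-th row consists of the coefficients of `∏ j ∈ S i, (X - α j)`. -/
noncomputable def rootCoeffMatrix {R : Type*} [CommRing R] {n k : ℕ} (S : Fin k → Finset (Fin n))
    (α : Fin n → R) : Matrix (Fin k) (Fin k) R :=
  Matrix.of fun i a => (rootPoly α (S i) 0).coeff a

section rootCoeffMatrix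

variable {R : Type*} [CommRing R] {n k : ℕ} (S : Fin k → Finset (Fin n))

theorem rootCoeffMatrix_map {R' : Type*} [CommRing R'] (f : R →+* R') (α : Fin n → R) :
    (rootCoeffMatrix S α).map f = rootCoeffMatrix S fun j => f (α j) := by
  ext i a
  simp [rootCoeffMatrix, ← coeff_map, rootPoly_map]

theorem rootCoeffMatrix_mul_vandermonde [Nontrivial R] (α : Fin n → R) {i : Fin k} {j : Fin n}
    (hcard : (S i).card < k) :
    (rootCoeffMatrix S α * Matrix.of fun (a : Fin k) (j : Fin n) => α j ^ (a : ℕ)) i j =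
      ∏ l ∈ S i, (α j - α l) := by
  have : (rootPoly α (S i) 0).eval (α j) = ∏ l ∈ S i, (α j - α l) := by
    simp [rootPoly, eval_prod]
  rw [← this, eval_eq_sum_range' (n := k) (by rwa [rootPoly_natDegree, add_zero]),
    Finset.sum_range, Matrix.mul_apply]
  rfl

theorem det_rootCoeffMatrix_ne_zero {L : Type*} [Field L] {α : Fin n → L}
    (hcard : ∀ i, (S i).card < k) (h : MultiplesIndep k Finset.univ S (fun _ => 0) α) :
    (rootCoeffMatrix S α).det ≠ 0 := by
  intro hdet
  obtain ⟨c, hc, hc0⟩ := Matrix.exists_vecMul_eq_zero_iff.2 hdet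
  refine hc (funext fun i => ?_)
  have hdeg (i : Fin k) : (C (c i) * rootPoly α (S i) 0).degree < k := by
    refine (degree_mul_rootPoly_lt_iff _ _ _ _ _).2 (lt_of_le_of_lt degree_C_le ?_)
    exact_mod_cast Nat.sub_pos_of_lt (hcard i)
  have := h (fun i => C (c i)) (fun i _ => hdeg i) ?_ i (Finset.mem_univ i)
  · simpa using this
  · ext a
    by_cases ha : a < k
    · have := congrFun hc0 ⟨a, ha⟩
      simpa [Matrix.vecMul, dotProduct, rootCoeffMatrix, finsetSum_coeff] using this
    · refine coeff_eq_zero_of_degree_lt (lt_of_lt_of_le ?_ (Nat.cast_le.2 (not_lt.1 ha)))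
      exact mem_degreeLT.1 <| Submodule.sum_mem _ fun i _ => mem_degreeLT.2 (hdeg i)

theorem degreeOf_coeff_rootPoly_le {F σ : Type*} [Field F] [DecidableEq σ] (T : Finset σ)
    (j : σ) (a : ℕ) : MvPolynomial.degreeOf j
      ((rootPoly (MvPolynomial.X : σ → MvPolynomial σ F) T 0).coeff a) ≤
        if j ∈ T then 1 else 0 := by
  induction T using Finset.induction_on generalizing a with
  | empty =>
    rw [rootPoly, pow_zero, Finset.prod_empty, one_mul, coeff_one]
    split_ifs <;> simp
  | insert l T hl ih =>
    have hX : MvPolynomial.degreeOf j (MvPolynomial.X l : MvPolynomial σ F) =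
        if j = l then 1 else 0 := by
      simp [MvPolynomial.degreeOf_X]
    rw [rootPoly_erase _ _ _ (Finset.mem_insert_self l T), Finset.erase_insert hl, sub_mul,
      coeff_sub, coeff_C_mul]
    refine (MvPolynomial.degreeOf_sub_le _ _ _).trans (max_le ?_ ?_)
    · cases a with
      | zero => simp
      | succ a =>
        rw [coeff_X_mul]
        refine (ih a).trans ?_
        split_ifs <;> simp_all
    · refine (MvPolynomial.degreeOf_mul_le _ _ _).trans ((Nat.add_le_add hX.le (ih a)).trans ?_)
      split_ifs <;> simp_all

end rootCoeffMatrix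

theorem MvPolynomial.degreeOf_det_le {R σ m : Type*} [CommRing R] [Fintype m] [DecidableEq m]
    (A : Matrix m m (MvPolynomial σ R)) (j : σ) (d : m → ℕ)
    (hA : ∀ i i', MvPolynomial.degreeOf j (A i i') ≤ d i) :
    MvPolynomial.degreeOf j A.det ≤ ∑ i, d i := by
  rw [← Matrix.det_transpose, Matrix.det_apply]
  refine (MvPolynomial.degreeOf_sum_le _ _ _).trans (Finset.sup_le fun p _ => ?_)
  have hprod : MvPolynomial.degreeOf j (∏ i, Aᵀ (p i) i) ≤ ∑ i, d i :=
    (MvPolynomial.degreeOf_prod_le _ _ _).trans (Finset.sum_le_sum fun i _ => hA _ _)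
  rcases Int.units_eq_one_or (Equiv.Perm.sign p) with h | h <;> rw [h]
  · simpa using hprod
  · simpa [MvPolynomial.degreeOf_neg] using hprod

theorem degreeOf_det_vandermonde_le {F : Type*} [Field F] {n : ℕ} (j : Fin n) :
    MvPolynomial.degreeOf j
      (Matrix.vandermonde (MvPolynomial.X : Fin n → MvPolynomial (Fin n) F)).det ≤ n - 1 := by
  refine (MvPolynomial.degreeOf_det_le _ j (fun i => if i = j then n - 1 else 0) ?_).trans
    (by simp)
  intro i a
  rw [Matrix.vandermonde_apply]
  refine (MvPolynomial.degreeOf_pow_le _ _ _).trans ?_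
  rw [MvPolynomial.degreeOf_X]
  split_ifs with h₁ h₂ h₂
  · have := a.2; omega
  · exact absurd h₁.symm h₂
  · simp
  · simp

theorem exists_eval_ne_zero_of_degreeOf_lt_card {F σ : Type*} [Field F] [Fintype F] [Finite σ]
    {P : MvPolynomial σ F} (hP : P ≠ 0) (hdeg : ∀ j, P.degreeOf j < Fintype.card F) :
    ∃ α, MvPolynomial.eval α P ≠ 0 := by
  by_contra! h
  exact hP (MvPolynomial.eq_zero_of_eval_zero_at_prod_finset P (fun _ => Finset.univ) hdeg
    fun x _ => h x)

theorem inf_card_add_card_le_of_mul_vandermonde {F : Type*} [Field F] {n k : ℕ}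
    {S : Fin k → Finset (Fin n)} {α : Fin n → F} (hα : Function.Injective α)
    {T : Matrix (Fin k) (Fin k) F} (hT : IsUnit T)
    (h : ∀ i, ∀ j ∈ S i,
      (T * Matrix.of fun (a : Fin k) (j : Fin n) => α j ^ (a : ℕ)) i j = 0)
    {Ω : Finset (Fin k)} (hΩ : Ω.Nonempty) : (Ω.inf S).card + Ω.card ≤ k := by
  have key (D : Finset (Fin n)) (hD : D ⊆ Ω.inf S) (hDk : D.card ≤ k) : D.card + Ω.card ≤ k := by
    let B : Matrix (Fin k) (Fin D.card) F :=
      Matrix.of fun a l => α (D.orderEmbOfFin rfl l) ^ (a : ℕ)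
    have hB : D.card ≤ B.rank := by
      have hsub : B.submatrix (Fin.castLE hDk) id =
          (Matrix.vandermonde fun l => α (D.orderEmbOfFin rfl l))ᵀ := rfl
      have hunit : IsUnit (Matrix.vandermonde fun l => α (D.orderEmbOfFin rfl l))ᵀ := by
        rw [Matrix.isUnit_iff_isUnit_det, isUnit_iff_ne_zero, Matrix.det_transpose,
          Matrix.det_vandermonde_ne_zero_iff]
        exact hα.comp (D.orderEmbOfFin rfl).injective
      have := B.rank_submatrix_le (Fin.castLE hDk) id
      rwa [hsub, Matrix.rank_of_isUnit _ hunit, Fintype.card_fin] at this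
    have hTΩ : (T.submatrix (fun i : Ω => (i : Fin k)) id).rank = Ω.card := by
      have hli : LinearIndependent F (T.submatrix (fun i : Ω => (i : Fin k)) id).row :=
        (Matrix.linearIndependent_rows_of_isUnit hT).comp _ Subtype.val_injective
      rw [hli.rank_matrix, Fintype.card_coe]
    have hzero : T.submatrix (fun i : Ω => (i : Fin k)) id * B = 0 := by
      ext i l
      refine h i _ ?_
      exact (Finset.inf_le (f := S) i.2) (hD (D.orderEmbOfFin_mem rfl l))
    have := Matrix.rank_add_rank_le_card_of_mul_eq_zero hzero
    rw [hTΩ, Fintype.card_fin] at this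
    omega
  rcases le_total (Ω.inf S).card k with hle | hle
  · exact key _ subset_rfl hle
  · obtain ⟨D, hD, hDk⟩ := Finset.exists_subset_card_eq hle
    have := key D hD hDk.le
    have := hΩ.card_pos
    omega

theorem exists_mul_vandermonde_of_inf_card_add_le {F : Type*} [Field F] [Fintype F] {n k : ℕ}
    (hk : 1 ≤ k) (hkn : k ≤ n) (S : Fin k → Finset (Fin n))
    (hq : n + k ≤ Fintype.card F + 1)
    (hS : ∀ Ω : Finset (Fin k), Ω.Nonempty → (Ω.inf S).card + Ω.card ≤ k) :
    ∃ α : Fin n → F, Function.Injective α ∧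
      ∃ T : Matrix (Fin k) (Fin k) F, IsUnit T ∧
        ∀ i, ∀ j ∈ S i,
          (T * Matrix.of fun (a : Fin k) (j : Fin n) => α j ^ (a : ℕ)) i j = 0 := by
  obtain ⟨S', hsub, hcard, hS'⟩ := exists_superset_card_eq_of_inf_card_add_le hkn S hS
  have hcard' (i : Fin k) : (S' i).card < k := by have := hcard i; omega
  obtain ⟨β, hβ⟩ := (supportCondition_of_inf_card_add_le S' hcard hS').exists_multiplesIndep
    (L := AlgebraicClosure F) (N := Finset.univ) fun i _ => Finset.subset_univ _
  set D : MvPolynomial (Fin n) F := (rootCoeffMatrix S' MvPolynomial.X).det with hDdef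
  have hD : D ≠ 0 := by
    intro hD
    refine det_rootCoeffMatrix_ne_zero S' hcard' hβ ?_
    have := congrArg (MvPolynomial.aeval β).toRingHom hD
    rw [hDdef, RingHom.map_det, RingHom.mapMatrix_apply, rootCoeffMatrix_map, map_zero] at this
    simpa using this
  have hV : (Matrix.vandermonde (MvPolynomial.X : Fin n → MvPolynomial (Fin n) F)).det ≠ 0 :=
    Matrix.det_vandermonde_ne_zero_iff.2 MvPolynomial.X_injective
  have hdegD (j : Fin n) : D.degreeOf j ≤ k - 1 := by
    refine (MvPolynomial.degreeOf_det_le _ j _ fun i a =>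
      degreeOf_coeff_rootPoly_le (S' i) j a).trans ?_
    rw [← Finset.card_filter]
    obtain ⟨i, hi⟩ : ∃ i, j ∉ S' i := by
      by_contra! hall
      have h1 := hS' Finset.univ ⟨⟨0, hk⟩, Finset.mem_univ _⟩
      have h2 : j ∈ Finset.univ.inf S' := by simpa [Finset.mem_inf] using hall
      have := Finset.card_pos.2 ⟨j, h2⟩
      rw [Finset.card_univ, Fintype.card_fin] at h1
      omega
    have := Finset.card_lt_card
      (Finset.filter_ssubset (p := fun i => j ∈ S' i).2 ⟨i, Finset.mem_univ i, hi⟩)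
    rw [Finset.card_univ, Fintype.card_fin] at this
    omega
  obtain ⟨α, hα⟩ := exists_eval_ne_zero_of_degreeOf_lt_card (mul_ne_zero hD hV) fun j => by
    have h1 := MvPolynomial.degreeOf_mul_le j D
      (Matrix.vandermonde (MvPolynomial.X : Fin n → MvPolynomial (Fin n) F)).det
    have h2 := degreeOf_det_vandermonde_le (F := F) j
    have h3 := hdegD j
    omega
  rw [map_mul, mul_ne_zero_iff, hDdef, RingHom.map_det, RingHom.map_det, RingHom.mapMatrix_apply,
    RingHom.mapMatrix_apply, rootCoeffMatrix_map] at hα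
  refine ⟨α, ?_, rootCoeffMatrix S' α, ?_, fun i j hj => ?_⟩
  · refine Matrix.det_vandermonde_ne_zero_iff.1 ?_
    convert hα.2
    ext; simp [Matrix.vandermonde_apply]
  · rw [Matrix.isUnit_iff_isUnit_det, isUnit_iff_ne_zero]
    simpa using hα.1
  · rw [rootCoeffMatrix_mul_vandermonde S' α (hcard' i)]
    exact Finset.prod_eq_zero (hsub i hj) (sub_self _)

/-- **Theorem 2 (the GM-MDS conjecture).** Let `S_1,…,S_k ⊆ [n]` and let `F` be a
finite field with `|F| ≥ n + k - 1` (stated as `n + k ≤ |F| + 1`).  Then every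
nonempty `Ω ⊆ [k]` satisfies `|⋂_{i∈Ω} S_i| ≤ k - |Ω|` (stated in the
subtraction-free form `|⋂_{i∈Ω} S_i| + |Ω| ≤ k`) iff there are distinct
`α_1,…,α_n ∈ F` and an invertible `T ∈ F^{k×k}` such that `G = T ⬝ V` (with `V`
the Vandermonde matrix `V i j = (α j)^i`) satisfies `G i j = 0` for all
`j ∈ S i`. -/
theorem stmt_3 {F : Type*} [Field F] [Fintype F] [DecidableEq F] {n k : ℕ}
    (hk : 1 ≤ k) (hkn : k ≤ n) (S : Fin k → Finset (Fin n))
    (hq : n + k ≤ Fintype.card F + 1) :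
    (∀ Ω : Finset (Fin k), Ω.Nonempty → (Ω.inf S).card + Ω.card ≤ k) ↔
      (∃ α : Fin n → F, Function.Injective α ∧
        ∃ T : Matrix (Fin k) (Fin k) F, IsUnit T ∧
          ∀ i, ∀ j ∈ S i,
            (T * Matrix.of fun (a : Fin k) (j : Fin n) => α j ^ (a : ℕ)) i j = 0) := by
  constructor
  · exact exists_mul_vandermonde_of_inf_card_add_le hk hkn S hq
  · rintro ⟨α, hα, T, hT, h⟩ Ω hΩ
    exact inf_card_add_card_le_of_mul_vandermonde hα hT h hΩ
end

section
/- Let k ≥ m ≥ 1, n ≥ 0, and [(S_i,r_i)]_{i=1}^m ∈ 𝒮_{k,m,n}. Then det M[(S_i,r_i)]_{i=1}^m ≠ 0 if and only if the family satisfies the GM-MDS condition, i.e., for every nonempty Ω ⊆ {1,…,m}: |∩_{i∈Ω} S_i| + ∑_{i∈Ω} r_i ≤ max_{i∈Ω}(|S_i| + r_i). -/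
open Polynomial

/-- `Kn n` is the field `K_n = ℚ(α_1,…,α_n)` of rational functions in `n`
indeterminates over `ℚ` (for `n = 0` it is just `ℚ` up to isomorphism). -/
noncomputable abbrev Kn (n : ℕ) : Type := FractionRing (MvPolynomial (Fin n) ℚ)

/-- The indeterminate `α_j` viewed as an element of `K_n`. -/
noncomputable def alf {n : ℕ} (j : Fin n) : Kn n :=
  algebraMap (MvPolynomial (Fin n) ℚ) (Kn n) (MvPolynomial.X j)

/-- The degree-`(k-1)` polynomial `x^(k-|S|-1) * ∏_{j ∈ S} (x + α_j)` whose
coefficients form the rows of a block of the matrix `M`. -/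
noncomputable def rowPoly {n : ℕ} (k : ℕ) (S : Finset (Fin n)) : Polynomial (Kn n) :=
  X ^ (k - S.card - 1) * ∏ j ∈ S, (X + C (alf j))

/-- The row offset of block `i`, namely `r_1 + ⋯ + r_{i-1}`. -/
def off {m : ℕ} (r : Fin m → ℕ) (i : Fin m) : ℕ :=
  ∑ j ∈ Finset.univ.filter (· < i), r j

/-- The `k × k` matrix `M[(S_i,r_i)]_{i=1}^m` over `K_n`: rows are grouped into `m`
blocks, block `i` consisting of the `r i` rows with (0-based) indices
`off r i ≤ ρ < off r i + r i`.  Writing `t = ρ - off r i` (so `0 ≤ t ≤ r i - 1`),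
the entry of such a row in (0-based) column `c` is the coefficient of
`x^(k-1-c+t)` in `rowPoly k (S i)` when `t ≤ c`, and `0` when `c < t`.
(When `∑ i, r i = k` the blocks exactly partition the `k` rows, so for each row
exactly one summand below is active.) -/
noncomputable def gmM {n m : ℕ} (k : ℕ) (S : Fin m → Finset (Fin n)) (r : Fin m → ℕ) :
    Matrix (Fin k) (Fin k) (Kn n) :=
  Matrix.of fun ρ c => ∑ i : Fin m,
    if off r i ≤ (ρ : ℕ) ∧ (ρ : ℕ) < off r i + r i ∧ (ρ : ℕ) - off r i ≤ (c : ℕ)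
    then (rowPoly k (S i)).coeff (k - 1 - (c : ℕ) + ((ρ : ℕ) - off r i)) else 0

section Independence

variable {ι : Type*} {n : ℕ}

/-- The polynomial `x ^ e * ∏_{j ∈ S} (x + α_j)` over `ℚ[α_1,…,α_n]`. -/
noncomputable def shiftedProd (S : Finset (Fin n)) (e : ℕ) :
    Polynomial (MvPolynomial (Fin n) ℚ) :=
  X ^ e * ∏ j ∈ S, (X + C (MvPolynomial.X j))

/-- The multiples `q_i * shiftedProd (S i) (e i)` with `deg q_i < r i`, `i ∈ T`, admit no
nontrivial vanishing sum. -/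
def OnlyTrivialRelation (T : Finset ι) (S : ι → Finset (Fin n)) (e r : ι → ℕ) : Prop :=
  ∀ q : ι → Polynomial (MvPolynomial (Fin n) ℚ), (∀ i ∈ T, (q i).degree < r i) →
    ∑ i ∈ T, q i * shiftedProd (S i) (e i) = 0 → ∀ i ∈ T, q i = 0

/-- The GM-MDS condition in terms of the multiplicity `e i = k - |S i| - r i` of the root `0`. -/
def MultiplicityCondition (k : ℕ) (T : Finset ι) (S : ι → Finset (Fin n)) (e r : ι → ℕ) : Prop :=
  (∀ i ∈ T, 1 ≤ r i ∧ (S i).card + e i + r i = k) ∧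
    ∀ I ⊆ T, I.Nonempty → ∃ i ∈ I, (I.inf S).card + e i + ∑ i ∈ I, r i ≤ k

lemma monic_shiftedProd (S : Finset (Fin n)) (e : ℕ) : (shiftedProd S e).Monic :=
  (monic_X_pow e).mul (monic_prod_of_monic _ _ fun _ _ => monic_X_add_C _)

lemma natDegree_shiftedProd (S : Finset (Fin n)) (e : ℕ) :
    (shiftedProd S e).natDegree = S.card + e := by
  rw [shiftedProd, (monic_X_pow e).natDegree_mul (monic_prod_of_monic _ _ fun _ _ =>
    monic_X_add_C _), natDegree_X_pow, natDegree_prod_of_monic _ _ fun _ _ => monic_X_add_C _]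
  simp [add_comm]

lemma degree_mul_shiftedProd_lt {S : Finset (Fin n)} {e r : ℕ}
    {q : Polynomial (MvPolynomial (Fin n) ℚ)} (hq : q.degree < r) :
    (q * shiftedProd S e).degree < ((S.card + e + r : ℕ) : WithBot ℕ) := by
  rcases eq_or_ne q 0 with rfl | h0
  · simp
  · have h := (natDegree_lt_iff_degree_lt h0).2 hq
    rw [← natDegree_lt_iff_degree_lt (mul_ne_zero h0 (monic_shiftedProd S e).ne_zero),
      natDegree_mul h0 (monic_shiftedProd S e).ne_zero, natDegree_shiftedProd]
    omega

lemma degree_lt_of_degree_mul_shiftedProd_lt {S : Finset (Fin n)} {e r : ℕ}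
    {q : Polynomial (MvPolynomial (Fin n) ℚ)}
    (hq : (q * shiftedProd S e).degree < ((S.card + e + r : ℕ) : WithBot ℕ)) :
    q.degree < r := by
  rcases eq_or_ne q 0 with rfl | h0
  · simp
  · rw [← natDegree_lt_iff_degree_lt (mul_ne_zero h0 (monic_shiftedProd S e).ne_zero),
      natDegree_mul h0 (monic_shiftedProd S e).ne_zero, natDegree_shiftedProd] at hq
    rw [← natDegree_lt_iff_degree_lt h0]
    omega

lemma shiftedProd_eq_mul {S S' : Finset (Fin n)} {e e' : ℕ} (hS : S' ⊆ S) (he : e' ≤ e) :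
    shiftedProd S e = shiftedProd (S \ S') (e - e') * shiftedProd S' e' := by
  rw [shiftedProd, shiftedProd, shiftedProd, ← Finset.prod_sdiff hS]
  nth_rw 1 [← Nat.sub_add_cancel he]
  ring

lemma X_pow_mul_shiftedProd (S : Finset (Fin n)) (d e : ℕ) :
    X ^ d * shiftedProd S e = shiftedProd S (d + e) := by
  rw [shiftedProd, shiftedProd, pow_add, mul_assoc]

lemma shiftedProd_succ (S : Finset (Fin n)) (e : ℕ) :
    shiftedProd S (e + 1) = X * shiftedProd S e := by
  rw [add_comm, ← X_pow_mul_shiftedProd, pow_one]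

/-- The substitution `α_j ↦ 0`. -/
noncomputable def substZero (j : Fin n) : MvPolynomial (Fin n) ℚ →ₐ[ℚ] MvPolynomial (Fin n) ℚ :=
  MvPolynomial.aeval (Function.update MvPolynomial.X j 0)

lemma X_dvd_of_substZero_eq_zero {j : Fin n} {p : MvPolynomial (Fin n) ℚ}
    (hp : substZero j p = 0) : MvPolynomial.X j ∣ p := by
  suffices h : ((Ideal.Quotient.mkₐ ℚ (Ideal.span {MvPolynomial.X j})).comp (substZero j)) =
      Ideal.Quotient.mkₐ ℚ (Ideal.span {(MvPolynomial.X j : MvPolynomial (Fin n) ℚ)}) by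
    have := DFunLike.congr_fun h p
    rw [AlgHom.comp_apply, hp, map_zero] at this
    rw [← Ideal.mem_span_singleton]
    exact Ideal.Quotient.eq_zero_iff_mem.1 this.symm
  refine MvPolynomial.algHom_ext fun l => ?_
  rw [AlgHom.comp_apply, substZero, MvPolynomial.aeval_X]
  rcases eq_or_ne l j with rfl | h
  · rw [Function.update_self, map_zero]
    exact (Ideal.Quotient.eq_zero_iff_mem.2 (Ideal.mem_span_singleton_self _)).symm
  · rw [Function.update_of_ne h]

lemma map_substZero_shiftedProd (j : Fin n) (S : Finset (Fin n)) (e : ℕ) :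
    (shiftedProd S e).map (substZero j : MvPolynomial (Fin n) ℚ →+* MvPolynomial (Fin n) ℚ) =
      shiftedProd (S.erase j) (if j ∈ S then e + 1 else e) := by
  have key : ∀ U : Finset (Fin n), j ∉ U → (∏ l ∈ U, (X + C (MvPolynomial.X l))).map
      (substZero j : MvPolynomial (Fin n) ℚ →+* MvPolynomial (Fin n) ℚ) =
        ∏ l ∈ U, (X + C (MvPolynomial.X l)) := by
    intro U hU
    rw [Polynomial.map_prod]
    refine Finset.prod_congr rfl fun l hl => ?_
    have : l ≠ j := fun h => hU (h ▸ hl)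
    simp [substZero, Function.update_of_ne this]
  by_cases h : j ∈ S
  · rw [if_pos h, shiftedProd, shiftedProd, ← Finset.mul_prod_erase S _ h, Polynomial.map_mul,
      Polynomial.map_mul, key _ (Finset.notMem_erase j S)]
    simp [substZero]
    ring
  · rw [if_neg h, Finset.erase_eq_of_notMem h, shiftedProd, Polynomial.map_mul, key _ h]
    simp

/-- A relation trivial after substituting `α_j = 0` was already trivial before. -/
lemma OnlyTrivialRelation.of_substZero {T : Finset ι} {S : ι → Finset (Fin n)} {e r : ι → ℕ}
    (j : Fin n) (h : OnlyTrivialRelation T (fun i => (S i).erase j)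
      (fun i => if j ∈ S i then e i + 1 else e i) r) : OnlyTrivialRelation T S e r := by
  have hX : (MvPolynomial.X j : MvPolynomial (Fin n) ℚ) ≠ 0 := MvPolynomial.X_ne_zero j
  intro q hdeg hq
  have hpow : ∀ N : ℕ, ∃ q' : ι → Polynomial (MvPolynomial (Fin n) ℚ),
      ∀ i ∈ T, q i = C (MvPolynomial.X j ^ N) * q' i := by
    intro N
    induction N with
    | zero => exact ⟨q, fun i _ => by simp⟩
    | succ N ih =>
      obtain ⟨q', hq'⟩ := ih
      have hN : (MvPolynomial.X j ^ N : MvPolynomial (Fin n) ℚ) ≠ 0 := pow_ne_zero N hX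
      have hrel : ∑ i ∈ T, q' i * shiftedProd (S i) (e i) = 0 := by
        refine (mul_eq_zero_iff_left (C_ne_zero.2 hN)).1 ?_
        rw [Finset.mul_sum, ← hq]
        exact Finset.sum_congr rfl fun i hi => by rw [hq' i hi, mul_assoc]
      have hz := h (fun i => (q' i).map (substZero j : _ →+* MvPolynomial (Fin n) ℚ))
        (fun i hi => degree_map_le.trans_lt (by
          have := hdeg i hi
          rwa [hq' i hi, degree_C_mul hN] at this))
        (by
          have := congrArg (Polynomial.map (substZero j : _ →+* MvPolynomial (Fin n) ℚ)) hrel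
          rw [Polynomial.map_sum, Polynomial.map_zero] at this
          simpa only [Polynomial.map_mul, map_substZero_shiftedProd] using this)
      have hdvd : ∀ i ∈ T, ∃ p, q' i = C (MvPolynomial.X j) * p := by
        intro i hi
        refine (C_dvd_iff_dvd_coeff _ _).2 fun d => X_dvd_of_substZero_eq_zero ?_
        have := congrArg (fun p => Polynomial.coeff p d) (hz i hi)
        simpa using this
      choose! p hp using hdvd
      exact ⟨p, fun i hi => by rw [hq' i hi, hp i hi, pow_succ, C_mul, mul_assoc]⟩
  intro i hi
  by_contra h0
  refine (FiniteMultiplicity.of_not_isUnit (a := C (MvPolynomial.X j)) (b := q i) ?_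
    h0).not_pow_dvd_of_multiplicity_lt (Nat.lt_succ_self _) ?_
  · rw [isUnit_C]
    exact (MvPolynomial.X_prime (R := ℚ) (i := j)).not_isUnit
  · obtain ⟨q', hq'⟩ := hpow (multiplicity (C (MvPolynomial.X j)) (q i) + 1)
    exact ⟨q' i, by rw [← C_pow]; exact hq' i hi⟩

lemma onlyTrivialRelation_of_pos {T : Finset ι} {S : ι → Finset (Fin n)} {e r : ι → ℕ}
    (he : ∀ i ∈ T, 1 ≤ e i) (h : OnlyTrivialRelation T S (fun i => e i - 1) r) :
    OnlyTrivialRelation T S e r := by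
  refine fun q hdeg hq => h q hdeg ((mul_eq_zero_iff_left X_ne_zero).1 ?_)
  rw [Finset.mul_sum, ← hq]
  refine Finset.sum_congr rfl fun i hi => ?_
  obtain ⟨d, hd⟩ := Nat.exists_eq_add_of_le' (he i hi)
  dsimp only
  rw [hd, shiftedProd_succ, Nat.add_sub_cancel]
  ring

lemma MultiplicityCondition.subset {k : ℕ} {T I : Finset ι} {S : ι → Finset (Fin n)}
    {e r : ι → ℕ} (h : MultiplicityCondition k T S e r) (hI : I ⊆ T) :
    MultiplicityCondition k I S e r :=
  ⟨fun i hi => h.1 i (hI hi), fun J hJ => h.2 J (hJ.trans hI)⟩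

lemma MultiplicityCondition.of_pos {k : ℕ} {T : Finset ι} {S : ι → Finset (Fin n)}
    {e r : ι → ℕ} (h : MultiplicityCondition k T S e r) (he : ∀ i ∈ T, 1 ≤ e i) :
    MultiplicityCondition (k - 1) T S (fun i => e i - 1) r := by
  refine ⟨fun i hi => ⟨(h.1 i hi).1, ?_⟩, fun J hJ hJne => ?_⟩
  · have := he i hi
    have := (h.1 i hi).2
    dsimp only
    omega
  · obtain ⟨i, hi, hle⟩ := h.2 J hJ hJne
    have := he i (hJ hi)
    exact ⟨i, hi, by dsimp only; omega⟩

lemma MultiplicityCondition.substZero {k : ℕ} {T : Finset ι} {S : ι → Finset (Fin n)}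
    {e r : ι → ℕ} (h : MultiplicityCondition k T S e r)
    (hloose : ∀ I ⊆ T, I ≠ T → 2 ≤ I.card → ∃ i ∈ I, (I.inf S).card + e i + ∑ i ∈ I, r i < k)
    {i₀ : ι} (hi₀ : i₀ ∈ T) (he₀ : e i₀ = 0) {j : Fin n} (hj : j ∉ S i₀) :
    MultiplicityCondition k T (fun i => (S i).erase j)
      (fun i => if j ∈ S i then e i + 1 else e i) r := by
  have hcard : ∀ i ∈ T, ((S i).erase j).card + (if j ∈ S i then e i + 1 else e i) + r i = k := by
    intro i hi
    have := (h.1 i hi).2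
    split_ifs with hji
    · have := Finset.card_erase_add_one hji
      omega
    · rwa [Finset.erase_eq_of_notMem hji]
  refine ⟨fun i hi => ⟨(h.1 i hi).1, hcard i hi⟩, fun J hJ hJne => ?_⟩
  have hinf : (J.inf fun i => (S i).erase j).card ≤ (J.inf S).card :=
    Finset.card_le_card (Finset.inf_mono_fun fun i _ => Finset.erase_subset _ _)
  rcases eq_or_ne J T with rfl | hJT
  · obtain ⟨i, hi, hle⟩ := h.2 J hJ hJne
    refine ⟨i₀, hi₀, ?_⟩
    simp only [if_neg hj, he₀]
    omega
  by_cases hJ2 : 2 ≤ J.card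
  · obtain ⟨i, hi, hlt⟩ := hloose J hJ hJT hJ2
    refine ⟨i, hi, ?_⟩
    dsimp only
    split_ifs <;> omega
  · obtain ⟨i, rfl⟩ := Finset.card_eq_one.1 (by have := hJne.card_pos; omega : J.card = 1)
    refine ⟨i, Finset.mem_singleton_self i, ?_⟩
    rw [Finset.inf_singleton, Finset.sum_singleton]
    exact (hcard i (hJ (Finset.mem_singleton_self i))).le

variable [DecidableEq ι]

/-- If only block `i₀` does not vanish at `0`, the constant term of its cofactor vanishes. -/
lemma onlyTrivialRelation_of_unique_zero {T : Finset ι} {S : ι → Finset (Fin n)} {e r : ι → ℕ}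
    {i₀ : ι} (hi₀ : i₀ ∈ T) (he₀ : e i₀ = 0) (hr₀ : 1 ≤ r i₀)
    (he : ∀ i ∈ T, i ≠ i₀ → 1 ≤ e i)
    (h : OnlyTrivialRelation (if r i₀ = 1 then T.erase i₀ else T) S (fun i => e i - 1)
      (Function.update r i₀ (r i₀ - 1))) :
    OnlyTrivialRelation T S e r := by
  intro q hdeg hq
  have hsplit := hq
  rw [← Finset.add_sum_erase T _ hi₀] at hsplit
  have hrest : ∑ i ∈ T.erase i₀, q i * shiftedProd (S i) (e i) =
      X * ∑ i ∈ T.erase i₀, q i * shiftedProd (S i) (e i - 1) := by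
    rw [Finset.mul_sum]
    refine Finset.sum_congr rfl fun i hi => ?_
    obtain ⟨d, hd⟩ := Nat.exists_eq_add_of_le'
      (he i (Finset.mem_of_mem_erase hi) (Finset.ne_of_mem_erase hi))
    rw [hd, shiftedProd_succ, Nat.add_sub_cancel]
    ring
  have hX : X ∣ q i₀ := by
    rw [X_dvd_iff, coeff_zero_eq_eval_zero]
    have h0 := congrArg (eval 0) hsplit
    rw [hrest, he₀] at h0
    simp only [shiftedProd, pow_zero, one_mul, eval_add, eval_mul, eval_X, zero_mul, add_zero,
      eval_zero, eval_prod, eval_C, zero_add] at h0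
    exact (mul_eq_zero.1 h0).resolve_right
      (Finset.prod_ne_zero_iff.2 fun j _ => MvPolynomial.X_ne_zero j)
  obtain ⟨p, hp⟩ := hX
  have hrel : p * shiftedProd (S i₀) (e i₀ - 1) +
      ∑ i ∈ T.erase i₀, q i * shiftedProd (S i) (e i - 1) = 0 := by
    refine (mul_eq_zero_iff_left X_ne_zero).1 ?_
    rw [← hsplit, hrest, hp, he₀]
    ring
  have hpdeg : p.degree < ((r i₀ - 1 : ℕ) : WithBot ℕ) := by
    rcases eq_or_ne p 0 with rfl | h0
    · simp
    · have := hdeg i₀ hi₀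
      rw [hp, ← natDegree_lt_iff_degree_lt (mul_ne_zero X_ne_zero h0), natDegree_X_mul h0] at this
      rw [← natDegree_lt_iff_degree_lt h0]
      omega
  have hupd : ∀ i ∈ T.erase i₀, Function.update q i₀ p i = q i := fun i hi =>
    Function.update_of_ne (Finset.ne_of_mem_erase hi) _ _
  have hsum : ∑ i ∈ T.erase i₀, Function.update q i₀ p i * shiftedProd (S i) (e i - 1) =
      ∑ i ∈ T.erase i₀, q i * shiftedProd (S i) (e i - 1) :=
    Finset.sum_congr rfl fun i hi => by rw [hupd i hi]
  have hdeg' : ∀ i ∈ T, (Function.update q i₀ p i).degree <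
      (Function.update r i₀ (r i₀ - 1) i : ℕ) := by
    intro i hi
    rcases eq_or_ne i i₀ with rfl | hne
    · simpa using hpdeg
    · simpa [Function.update_of_ne hne] using hdeg i hi
  have hall : p = 0 ∧ ∀ i ∈ T.erase i₀, q i = 0 := by
    split_ifs at h with h1
    · have hp0 : p = 0 := by
        by_contra h0
        rw [h1, ← natDegree_lt_iff_degree_lt h0] at hpdeg
        omega
      refine ⟨hp0, fun i hi => ?_⟩
      rw [hp0, zero_mul, zero_add] at hrel
      rw [← hupd i hi]
      exact h _ (fun i hi => hdeg' i (Finset.mem_of_mem_erase hi)) (hsum.trans hrel) i hi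
    · have := h _ hdeg' (by
        rw [← Finset.add_sum_erase T _ hi₀, hsum, Function.update_self, hrel])
      exact ⟨by simpa using this i₀ hi₀, fun i hi => by
        rw [← hupd i hi]; exact this i (Finset.mem_of_mem_erase hi)⟩
  intro i hi
  rcases eq_or_ne i i₀ with rfl | hne
  · rw [hp, hall.1, mul_zero]
  · exact hall.2 i (Finset.mem_erase.2 ⟨hne, hi⟩)

/-- A tight subfamily may be replaced by the single block of its common divisor. -/
lemma onlyTrivialRelation_of_merge {k : ℕ} {T I : Finset ι} {S : ι → Finset (Fin n)}
    {e r : ι → ℕ} {i₀ : ι} (hIT : I ⊆ T) (hi₀ : i₀ ∈ I)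
    (hk : ∀ i ∈ I, (S i).card + e i + r i = k) (hmin : ∀ i ∈ I, e i₀ ≤ e i)
    (htight : (I.inf S).card + e i₀ + ∑ i ∈ I, r i = k)
    (hI : OnlyTrivialRelation I S e r)
    (hT : OnlyTrivialRelation (insert i₀ (T \ I)) (Function.update S i₀ (I.inf S)) e
      (Function.update r i₀ (∑ i ∈ I, r i))) :
    OnlyTrivialRelation T S e r := by
  intro q hdeg hq
  have hdvd : shiftedProd (I.inf S) (e i₀) ∣ ∑ i ∈ I, q i * shiftedProd (S i) (e i) :=
    Finset.dvd_sum fun i hi => Dvd.dvd.mul_left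
      ⟨_, (shiftedProd_eq_mul (Finset.inf_le hi) (hmin i hi)).trans (mul_comm _ _)⟩ _
  obtain ⟨p, hp⟩ := hdvd
  rw [mul_comm] at hp
  have hpdeg : p.degree < ((∑ i ∈ I, r i : ℕ) : WithBot ℕ) := by
    refine degree_lt_of_degree_mul_shiftedProd_lt (S := I.inf S) (e := e i₀) ?_
    rw [← hp, htight]
    refine (degree_sum_le _ _).trans_lt ((Finset.sup_lt_iff (WithBot.bot_lt_coe k)).2
      fun i hi => ?_)
    have := degree_mul_shiftedProd_lt (S := S i) (e := e i) (hdeg i (hIT hi))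
    rwa [hk i hi] at this
  have hne : ∀ i ∈ T \ I, i ≠ i₀ := fun i hi h => (Finset.mem_sdiff.1 hi).2 (h ▸ hi₀)
  have hzero := hT (Function.update q i₀ p)
    (by
      intro i hi
      rcases Finset.mem_insert.1 hi with rfl | hi
      · simpa using hpdeg
      · simpa [Function.update_of_ne (hne i hi)] using hdeg i (Finset.sdiff_subset hi))
    (by
      rw [Finset.sum_insert fun h => hne i₀ h rfl, Function.update_self, Function.update_self,
        ← hp, ← hq, ← Finset.sum_sdiff hIT, add_comm]
      congr 1
      exact Finset.sum_congr rfl fun i hi => by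
        rw [Function.update_of_ne (hne i hi), Function.update_of_ne (hne i hi)])
  have hp0 : p = 0 := by simpa using hzero i₀ (Finset.mem_insert_self _ _)
  intro i hi
  by_cases hiI : i ∈ I
  · exact hI q (fun i hi => hdeg i (hIT hi)) (by rw [hp, hp0, zero_mul]) i hiI
  · have hi' := Finset.mem_sdiff.2 ⟨hi, hiI⟩
    have := hzero i (Finset.mem_insert_of_mem hi')
    rwa [Function.update_of_ne (hne i hi')] at this

lemma MultiplicityCondition.merge {k : ℕ} {T I : Finset ι} {S : ι → Finset (Fin n)}
    {e r : ι → ℕ} {i₀ : ι} (h : MultiplicityCondition k T S e r) (hIT : I ⊆ T) (hi₀ : i₀ ∈ I)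
    (hmin : ∀ i ∈ I, e i₀ ≤ e i) (htight : (I.inf S).card + e i₀ + ∑ i ∈ I, r i = k) :
    MultiplicityCondition k (insert i₀ (T \ I)) (Function.update S i₀ (I.inf S)) e
      (Function.update r i₀ (∑ i ∈ I, r i)) := by
  have hne : ∀ i ∈ T \ I, i ≠ i₀ := fun i hi h => (Finset.mem_sdiff.1 hi).2 (h ▸ hi₀)
  constructor
  · intro i hi
    rcases Finset.mem_insert.1 hi with rfl | hi
    · rw [Function.update_self, Function.update_self]
      exact ⟨(h.1 i (hIT hi₀)).1.trans (Finset.single_le_sum_of_canonicallyOrdered hi₀), htight⟩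
    · rw [Function.update_of_ne (hne i hi), Function.update_of_ne (hne i hi)]
      exact h.1 i (Finset.sdiff_subset hi)
  · intro J hJ hJne
    by_cases hmem : i₀ ∈ J
    · have hJ' : J.erase i₀ ⊆ T \ I := by
        rw [Finset.subset_insert_iff] at hJ
        exact hJ
      have hdisj : Disjoint (J.erase i₀) I :=
        Finset.disjoint_left.2 fun i hi => (Finset.mem_sdiff.1 (hJ' hi)).2
      obtain ⟨i, hi, hle⟩ := h.2 (J.erase i₀ ∪ I)
        (Finset.union_subset (hJ'.trans Finset.sdiff_subset) hIT) ⟨i₀, Finset.mem_union_right _ hi₀⟩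
      have hinf : J.inf (Function.update S i₀ (I.inf S)) = (J.erase i₀ ∪ I).inf S := by
        rw [← Finset.insert_erase hmem, Finset.inf_insert, Function.update_self, Finset.inf_union,
          inf_comm, Finset.erase_insert_eq_erase, Finset.erase_idem]
        congr 1
        exact Finset.inf_congr rfl fun i hi => Function.update_of_ne (hne i (hJ' hi)) _ _
      have hsum : ∑ i ∈ J, Function.update r i₀ (∑ i ∈ I, r i) i = ∑ i ∈ J.erase i₀ ∪ I, r i := by
        rw [← Finset.add_sum_erase J _ hmem, Function.update_self, Finset.sum_union hdisj, add_comm]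
        congr 1
        exact Finset.sum_congr rfl fun i hi => Function.update_of_ne (hne i (hJ' hi)) _ _
      rw [hinf, hsum]
      rcases Finset.mem_union.1 hi with hi | hi
      · exact ⟨i, Finset.mem_of_mem_erase hi, hle⟩
      · exact ⟨i₀, hmem, by have := hmin i hi; omega⟩
    · have hJ' : J ⊆ T \ I := (Finset.subset_insert_iff_of_notMem hmem).1 hJ
      obtain ⟨i, hi, hle⟩ := h.2 J (hJ'.trans Finset.sdiff_subset) hJne
      refine ⟨i, hi, ?_⟩
      rwa [Finset.inf_congr rfl fun i hi => Function.update_of_ne (hne i (hJ' hi)) _ _,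
        Finset.sum_congr rfl fun i hi => Function.update_of_ne (hne i (hJ' hi)) _ _]

lemma MultiplicityCondition.of_unique_zero {k : ℕ} {T : Finset ι} {S : ι → Finset (Fin n)}
    {e r : ι → ℕ} {i₀ : ι} (h : MultiplicityCondition k T S e r) (hi₀ : i₀ ∈ T) (he₀ : e i₀ = 0)
    (he : ∀ i ∈ T, i ≠ i₀ → 1 ≤ e i) :
    MultiplicityCondition (k - 1) (if r i₀ = 1 then T.erase i₀ else T) S (fun i => e i - 1)
      (Function.update r i₀ (r i₀ - 1)) := by
  have hr₀ := (h.1 i₀ hi₀).1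
  have hsub : (if r i₀ = 1 then T.erase i₀ else T) ⊆ T := by
    split_ifs
    exacts [Finset.erase_subset _ _, subset_rfl]
  constructor
  · intro i hi
    have hiT := h.1 i (hsub hi)
    rcases eq_or_ne i i₀ with rfl | hne
    · rw [Function.update_self]
      split_ifs at hi with h1
      · simp at hi
      · dsimp only
        omega
    · have := he i (hsub hi) hne
      rw [Function.update_of_ne hne]
      dsimp only
      omega
  · intro J hJ hJne
    obtain ⟨i, hi, hle⟩ := h.2 J (hJ.trans hsub) hJne
    by_cases hmem : i₀ ∈ J
    · refine ⟨i₀, hmem, ?_⟩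
      rw [← Finset.add_sum_erase J _ hmem] at hle ⊢
      rw [Function.update_self, Finset.sum_congr rfl fun i hi =>
        Function.update_of_ne (Finset.ne_of_mem_erase hi) _ _]
      dsimp only
      omega
    · have hJ' : ∀ i ∈ J, i ≠ i₀ := fun i hi h => hmem (h ▸ hi)
      have := he i (hsub (hJ hi)) (hJ' i hi)
      refine ⟨i, hi, ?_⟩
      rw [Finset.sum_congr rfl fun i hi => Function.update_of_ne (hJ' i hi) _ _]
      dsimp only
      omega

/-- Without proper tight subfamilies, setting `α_j = 0` preserves the condition, provided that
some block has neither `0` nor `-α_j` as a root. -/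

theorem MultiplicityCondition.onlyTrivialRelation {k : ℕ} {T : Finset ι}
    {S : ι → Finset (Fin n)} {e r : ι → ℕ} (h : MultiplicityCondition k T S e r) :
    OnlyTrivialRelation T S e r := by
  induction hN : k + T.card + ∑ i ∈ T, (S i).card using Nat.strong_induction_on
    generalizing k T S e r with
  | _ N ih =>
  subst hN
  rcases T.eq_empty_or_nonempty with rfl | ⟨i₁, hi₁⟩
  · intro q _ _ i hi
    simp at hi
  have hkpos : 1 ≤ k := by
    have := h.1 i₁ hi₁
    omega
  by_cases hloose : ∀ I ⊆ T, I ≠ T → 2 ≤ I.card →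
      ∃ i ∈ I, (I.inf S).card + e i + ∑ i ∈ I, r i < k
  · by_cases hpos : ∀ i ∈ T, 1 ≤ e i
    · exact onlyTrivialRelation_of_pos hpos (ih _ (by omega) (h.of_pos hpos) rfl)
    push Not at hpos
    obtain ⟨i₀, hi₀, he₀⟩ := hpos
    replace he₀ : e i₀ = 0 := by omega
    by_cases huniq : ∀ i ∈ T, i ≠ i₀ → 1 ≤ e i
    · refine onlyTrivialRelation_of_unique_zero hi₀ he₀ (h.1 i₀ hi₀).1 huniq
        (ih _ ?_ (h.of_unique_zero hi₀ he₀ huniq) rfl)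
      have hsub : (if r i₀ = 1 then T.erase i₀ else T) ⊆ T := by
        split_ifs
        exacts [Finset.erase_subset _ _, subset_rfl]
      have h1 := Finset.card_le_card hsub
      have h2 := Finset.sum_le_sum_of_subset (f := fun i => (S i).card) hsub
      omega
    push Not at huniq
    obtain ⟨i₂, hi₂, hne, he₂⟩ := huniq
    replace he₂ : e i₂ = 0 := by omega
    have hsep : ∃ a ∈ T, e a = 0 ∧ ∃ b ∈ T, ∃ j ∈ S b, j ∉ S a := by
      by_cases hs : S i₂ ⊆ S i₀
      · by_cases hs' : S i₀ ⊆ S i₂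
        · exfalso
          obtain ⟨i, hi, hle⟩ := h.2 {i₀, i₂} (by simp [Finset.insert_subset_iff, hi₀, hi₂])
            ⟨i₀, by simp⟩
          rw [Finset.sum_pair hne.symm, Finset.inf_insert, Finset.inf_singleton, hs.antisymm hs',
            inf_idem] at hle
          have h0 := h.1 i₀ hi₀
          have h2 := h.1 i₂ hi₂
          omega
        · obtain ⟨j, hj, hj'⟩ := Finset.not_subset.1 hs'
          exact ⟨i₂, hi₂, he₂, i₀, hi₀, j, hj, hj'⟩
      · obtain ⟨j, hj, hj'⟩ := Finset.not_subset.1 hs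
        exact ⟨i₀, hi₀, he₀, i₂, hi₂, j, hj, hj'⟩
    obtain ⟨a, ha, hea, b, hb, j, hjb, hja⟩ := hsep
    refine OnlyTrivialRelation.of_substZero j (ih _ ?_ (h.substZero hloose ha hea hja) rfl)
    refine Nat.add_lt_add_left (Finset.sum_lt_sum (fun i _ => Finset.card_erase_le)
      ⟨b, hb, Finset.card_erase_lt_of_mem hjb⟩) _
  · push Not at hloose
    obtain ⟨I, hIT, hne, hI2, htight⟩ := hloose
    have hIne : I.Nonempty := Finset.card_pos.1 (by omega)
    obtain ⟨i₀, hi₀, hmin⟩ := I.exists_min_image e hIne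
    have heq : (I.inf S).card + e i₀ + ∑ i ∈ I, r i = k := by
      obtain ⟨i, hi, hle⟩ := h.2 I hIT hIne
      have := hmin i hi
      have := htight i₀ hi₀
      omega
    have hlt : I.card < T.card := Finset.card_lt_card (hIT.ssubset_of_ne hne)
    refine onlyTrivialRelation_of_merge hIT hi₀ (fun i hi => (h.1 i (hIT hi)).2) hmin heq
      (ih _ ?_ (h.subset hIT) rfl) (ih _ ?_ (h.merge hIT hi₀ hmin heq) rfl)
    · have := Finset.sum_le_sum_of_subset (f := fun i => (S i).card) hIT
      omega
    · have hi₀T : i₀ ∉ T \ I := fun h => (Finset.mem_sdiff.1 h).2 hi₀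
      have hsub : insert i₀ (T \ I) ⊆ T :=
        Finset.insert_subset (hIT hi₀) Finset.sdiff_subset
      have h1 : (insert i₀ (T \ I)).card = T.card - I.card + 1 := by
        rw [Finset.card_insert_of_notMem hi₀T, Finset.card_sdiff_of_subset hIT]
      have h2 : ∑ i ∈ insert i₀ (T \ I), (Function.update S i₀ (I.inf S) i).card ≤
          ∑ i ∈ T, (S i).card := by
        refine (Finset.sum_le_sum fun i _ => Finset.card_le_card ?_).trans
          (Finset.sum_le_sum_of_subset (f := fun i => (S i).card) hsub)
        rcases eq_or_ne i i₀ with rfl | hne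
        · rw [Function.update_self]
          exact Finset.inf_le hi₀
        · rw [Function.update_of_ne hne]
      omega

end Independence

section Matrix

/-- The polynomial of degree less than `r` with coefficients `w`, highest degree first. -/
noncomputable def polyOfVec {R : Type*} [CommRing R] {r : ℕ} (w : Fin r → R) : Polynomial R :=
  ∑ t : Fin r, C (w t) * X ^ (r - 1 - (t : ℕ))

lemma degree_polyOfVec_lt {R : Type*} [CommRing R] {r : ℕ} (w : Fin r → R) :
    (polyOfVec w).degree < r := by
  refine (degree_sum_le _ _).trans_lt ((Finset.sup_lt_iff (WithBot.bot_lt_coe r)).2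
    fun t _ => (degree_C_mul_X_pow_le _ _).trans_lt ?_)
  exact Nat.cast_lt.2 (by have := t.2; omega)

lemma coeff_polyOfVec {R : Type*} [CommRing R] {r : ℕ} (w : Fin r → R) (t : Fin r) :
    (polyOfVec w).coeff (r - 1 - (t : ℕ)) = w t := by
  rw [polyOfVec, finsetSum_coeff, Finset.sum_eq_single t]
  · rw [coeff_C_mul_X_pow, if_pos rfl]
  · intro s _ hs
    rw [coeff_C_mul_X_pow, if_neg]
    intro h
    exact hs (Fin.ext (by have := t.2; have := s.2; omega))
  · simp

lemma polyOfVec_coeff {R : Type*} [CommRing R] {r : ℕ} {q : Polynomial R} (hq : q.degree < r) :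
    polyOfVec (fun t : Fin r => q.coeff (r - 1 - (t : ℕ))) = q := by
  ext d
  by_cases hd : d < r
  · have := coeff_polyOfVec (fun t : Fin r => q.coeff (r - 1 - (t : ℕ))) ⟨r - 1 - d, by omega⟩
    dsimp only at this
    rwa [show r - 1 - (r - 1 - d) = d by omega] at this
  · have hd' : (r : WithBot ℕ) ≤ d := by exact_mod_cast not_lt.1 hd
    rw [coeff_eq_zero_of_degree_lt (hq.trans_le hd'),
      coeff_eq_zero_of_degree_lt ((degree_polyOfVec_lt _).trans_le hd')]

variable {m n : ℕ}

lemma OnlyTrivialRelation.exists_card_inf_add_sum_le {ι : Type*} [Fintype ι] {k : ℕ}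
    {S : ι → Finset (Fin n)} {e r : ι → ℕ} (h : OnlyTrivialRelation Finset.univ S e r)
    (hk : ∀ i, (S i).card + e i + r i = k) {I : Finset ι} (hI : I.Nonempty) :
    ∃ i ∈ I, (I.inf S).card + e i + ∑ i ∈ I, r i ≤ k := by
  classical
  obtain ⟨i₀, hi₀, hmin⟩ := I.exists_min_image e hI
  refine ⟨i₀, hi₀, ?_⟩
  let r' : ι → ℕ := fun i => if i ∈ I then r i else 0
  let g : ι → Polynomial (MvPolynomial (Fin n) ℚ) := fun i =>
    shiftedProd (S i \ I.inf S) (e i - e i₀)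
  let L : ((Σ i, Fin (r' i)) → MvPolynomial (Fin n) ℚ) →ₗ[MvPolynomial (Fin n) ℚ]
      (Fin (k - (I.inf S).card - e i₀) → MvPolynomial (Fin n) ℚ) :=
    { toFun := fun w c => (∑ i, polyOfVec (fun t => w ⟨i, t⟩) * g i).coeff c
      map_add' := fun w w' => by
        ext1 c
        simp only [polyOfVec, Pi.add_apply, C_add, add_mul, Finset.sum_add_distrib, coeff_add]
      map_smul' := fun a w => by
        ext1 c
        simp only [polyOfVec, Pi.smul_apply, smul_eq_mul, C_mul, mul_assoc, ← Finset.mul_sum,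
          coeff_C_mul, RingHom.id_apply] }
  have hLapply : ∀ w c, L w c = (∑ i, polyOfVec (fun t => w ⟨i, t⟩) * g i).coeff c :=
    fun _ _ => rfl
  have hL : Function.Injective L := by
    rw [← LinearMap.ker_eq_bot, LinearMap.ker_eq_bot']
    intro w hw
    have hnotMem : ∀ i ∉ I, polyOfVec (fun t => w ⟨i, t⟩) = 0 := by
      intro i hi
      have : IsEmpty (Fin (r' i)) := by
        rw [show r' i = 0 from if_neg hi]
        infer_instance
      exact Finset.sum_of_isEmpty _
    have hsum : ∑ i, polyOfVec (fun t => w ⟨i, t⟩) * g i = 0 := by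
      ext1 d
      by_cases hd : d < k - (I.inf S).card - e i₀
      · rw [coeff_zero, ← hLapply w ⟨d, hd⟩, hw, Pi.zero_apply]
      rw [finsetSum_coeff, coeff_zero]
      refine Finset.sum_eq_zero fun i _ => ?_
      by_cases hi : i ∈ I
      · refine coeff_eq_zero_of_degree_lt
          ((degree_mul_shiftedProd_lt (degree_polyOfVec_lt _)).trans_le ?_)
        have h1 : (S i \ I.inf S).card = (S i).card - (I.inf S).card :=
          Finset.card_sdiff_of_subset (Finset.inf_le hi)
        have h2 : r' i = r i := if_pos hi
        have h3 := Finset.card_le_card (Finset.inf_le hi : I.inf S ≤ S i)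
        have h4 := hmin i hi
        have h5 := hk i
        exact_mod_cast (by omega : (S i \ I.inf S).card + (e i - e i₀) + r' i ≤ d)
      · rw [hnotMem i hi, zero_mul, coeff_zero]
    have hzero := h (fun i => polyOfVec (fun t => w ⟨i, t⟩))
      (fun i _ => (degree_polyOfVec_lt _).trans_le (by
        exact_mod_cast (by dsimp only [r']; split_ifs <;> omega : r' i ≤ r i)))
      (by
        rw [← zero_mul (shiftedProd (I.inf S) (e i₀)), ← hsum, Finset.sum_mul]
        refine Finset.sum_congr rfl fun i _ => ?_
        by_cases hi : i ∈ I
        · rw [shiftedProd_eq_mul (Finset.inf_le hi) (hmin i hi), mul_assoc]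
        · rw [hnotMem i hi]
          simp)
    ext1 ⟨i, t⟩
    rw [← coeff_polyOfVec (fun t => w ⟨i, t⟩) t, hzero i (Finset.mem_univ i)]
    simp
  have hcard := card_le_of_injective _ L hL
  rw [Fintype.card_sigma, Fintype.card_fin] at hcard
  simp only [Fintype.card_fin, r', Finset.sum_ite_mem, Finset.univ_inter] at hcard
  have h1 := hk i₀
  have h2 := Finset.card_le_card (Finset.inf_le hi₀ : I.inf S ≤ S i₀)
  omega

/-- The enumeration of the rows of `gmM` by block and position inside the block. -/
def rowEquiv {k : ℕ} {r : Fin m → ℕ} (hsum : ∑ i, r i = k) : (Σ i, Fin (r i)) ≃ Fin k :=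
  finSigmaFinEquiv.trans (finCongr hsum)

lemma rowEquiv_val {k : ℕ} {r : Fin m → ℕ} (hsum : ∑ i, r i = k) (p : Σ i, Fin (r i)) :
    (rowEquiv hsum p : ℕ) = off r p.1 + p.2 := by
  rw [rowEquiv, Equiv.trans_apply, finCongr_apply, Fin.val_cast, finSigmaFinEquiv_apply, off]
  congr 1
  refine Finset.sum_bij (fun j _ => Fin.castLE p.1.2.le j) ?_ ?_ ?_ ?_
  · intro j _
    exact Finset.mem_filter.2 ⟨Finset.mem_univ _, j.2⟩
  · intro j _ j' _ h
    simpa using h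
  · intro j hj
    exact ⟨⟨j, (Finset.mem_filter.1 hj).2⟩, Finset.mem_univ _, rfl⟩
  · intro j _
    rfl

/-- The matrix of coefficients of the polynomials `x ^ (r i - 1 - t) * shiftedProd (S i) (e i)`,
with rows and columns indexed by block and position. -/
noncomputable def blockMatrix {k : ℕ} (S : Fin m → Finset (Fin n)) (e : Fin m → ℕ)
    {r : Fin m → ℕ} (hsum : ∑ i, r i = k) :
    Matrix (Σ i, Fin (r i)) (Σ i, Fin (r i)) (MvPolynomial (Fin n) ℚ) :=
  Matrix.of fun p c => (X ^ (r p.1 - 1 - (p.2 : ℕ)) * shiftedProd (S p.1) (e p.1)).coeff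
    (k - 1 - (rowEquiv hsum c : ℕ))

lemma map_shiftedProd (k : ℕ) (S : Finset (Fin n)) :
    (shiftedProd S (k - S.card - 1)).map (algebraMap (MvPolynomial (Fin n) ℚ) (Kn n)) =
      rowPoly k S := by
  simp [shiftedProd, rowPoly, Polynomial.map_prod, alf]

lemma gmM_eq_submatrix {k : ℕ} {S : Fin m → Finset (Fin n)} {r : Fin m → ℕ}
    (hcard : ∀ i, (S i).card + r i ≤ k) (hsum : ∑ i, r i = k) :
    gmM k S r = ((blockMatrix S (fun i => k - (S i).card - r i) hsum).map
      (algebraMap (MvPolynomial (Fin n) ℚ) (Kn n))).submatrix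
        (rowEquiv hsum).symm (rowEquiv hsum).symm := by
  ext ρ c
  obtain ⟨⟨i, t⟩, rfl⟩ := (rowEquiv hsum).surjective ρ
  obtain ⟨c, rfl⟩ := (rowEquiv hsum).surjective c
  rw [Matrix.submatrix_apply, Equiv.symm_apply_apply, Equiv.symm_apply_apply, Matrix.map_apply,
    blockMatrix, Matrix.of_apply, ← coeff_map, gmM, Matrix.of_apply, Finset.sum_eq_single i]
  · have hval := rowEquiv_val hsum ⟨i, t⟩
    dsimp only at hval ⊢
    have ht := t.2
    have hc := (rowEquiv hsum c).2
    have hS := hcard i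
    have hrow : shiftedProd (S i) (k - (S i).card - 1) =
        X ^ (t : ℕ) * (X ^ (r i - 1 - (t : ℕ)) * shiftedProd (S i) (k - (S i).card - r i)) := by
      rw [X_pow_mul_shiftedProd, X_pow_mul_shiftedProd]
      congr 1
      omega
    rw [hval, ← map_shiftedProd, coeff_map, coeff_map, Nat.add_sub_cancel_left]
    split_ifs with h
    · rw [hrow, coeff_X_pow_mul]
    · rw [coeff_eq_zero_of_natDegree_lt, map_zero]
      rw [X_pow_mul_shiftedProd, natDegree_shiftedProd]
      omega
  · intro i' _ hi'
    rw [if_neg]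
    rintro ⟨h1, h2, -⟩
    refine hi' ?_
    have : rowEquiv hsum ⟨i', ⟨rowEquiv hsum ⟨i, t⟩ - off r i', by omega⟩⟩ =
        rowEquiv hsum ⟨i, t⟩ := Fin.ext (by rw [rowEquiv_val]; dsimp only; omega)
    exact congrArg Sigma.fst ((rowEquiv hsum).injective this)
  · simp

lemma vecMul_blockMatrix {k : ℕ} (S : Fin m → Finset (Fin n)) (e : Fin m → ℕ)
    {r : Fin m → ℕ} (hsum : ∑ i, r i = k) (v : (Σ i, Fin (r i)) → MvPolynomial (Fin n) ℚ)
    (c : Σ i, Fin (r i)) :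
    Matrix.vecMul v (blockMatrix S e hsum) c =
      (∑ i, polyOfVec (fun t => v ⟨i, t⟩) * shiftedProd (S i) (e i)).coeff
        (k - 1 - (rowEquiv hsum c : ℕ)) := by
  rw [Matrix.vecMul, dotProduct, Fintype.sum_sigma, finsetSum_coeff]
  refine Finset.sum_congr rfl fun i _ => ?_
  rw [polyOfVec, Finset.sum_mul, finsetSum_coeff]
  refine Finset.sum_congr rfl fun t _ => ?_
  rw [mul_assoc, coeff_C_mul, blockMatrix, Matrix.of_apply]

lemma det_blockMatrix_ne_zero_iff {k : ℕ} {S : Fin m → Finset (Fin n)} {e r : Fin m → ℕ}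
    (hk : ∀ i, (S i).card + e i + r i = k) (hsum : ∑ i, r i = k) :
    (blockMatrix S e hsum).det ≠ 0 ↔ OnlyTrivialRelation Finset.univ S e r := by
  rw [Ne, ← Matrix.exists_vecMul_eq_zero_iff, not_exists]
  constructor
  · intro h q hdeg hq i _
    have hw : ∀ i, ∃ w : Fin (r i) → MvPolynomial (Fin n) ℚ, polyOfVec w = q i := fun i =>
      ⟨_, polyOfVec_coeff (q := q i) (hdeg i (Finset.mem_univ i))⟩
    choose w hw using hw
    have hw0 : (fun p : Σ i, Fin (r i) => w p.1 p.2) = 0 := by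
      by_contra hne
      refine h _ ⟨hne, funext fun c => ?_⟩
      rw [vecMul_blockMatrix, Finset.sum_congr rfl fun i _ => congrArg (· * _) (hw i), hq,
        coeff_zero, Pi.zero_apply]
    rw [← hw i, polyOfVec]
    refine Finset.sum_eq_zero fun t _ => ?_
    rw [show w i t = 0 from congrFun hw0 ⟨i, t⟩, C_0, zero_mul]
  · rintro h v ⟨hv0, hv⟩
    refine hv0 (funext fun ⟨i, t⟩ => ?_)
    have hzero := h (fun i => polyOfVec fun t => v ⟨i, t⟩) (fun i _ => degree_polyOfVec_lt _)
      (by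
        ext1 d
        rw [coeff_zero]
        by_cases hd : d < k
        · have := congrFun hv ((rowEquiv hsum).symm ⟨k - 1 - d, by omega⟩)
          rw [vecMul_blockMatrix, Equiv.apply_symm_apply] at this
          dsimp only at this
          rwa [show k - 1 - (k - 1 - d) = d by omega] at this
        · refine coeff_eq_zero_of_degree_lt ((degree_sum_le _ _).trans_lt
            ((Finset.sup_lt_iff (WithBot.bot_lt_coe d)).2 fun i _ =>
              (degree_mul_shiftedProd_lt (degree_polyOfVec_lt _)).trans_le ?_))
          rw [hk i]
          exact Nat.cast_le.2 (not_lt.1 hd))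
    rw [← coeff_polyOfVec (fun t => v ⟨i, t⟩) t, hzero i (Finset.mem_univ i)]
    simp

end Matrix

/-- **Main theorem.** For `[(S_i,r_i)]_{i=1}^m ∈ 𝒮_{k,m,n}`, the determinant of
`M[(S_i,r_i)]_{i=1}^m` is nonzero iff for every nonempty `Ω ⊆ [m]`,
`|⋂_{i∈Ω} S_i| + ∑_{i∈Ω} r_i ≤ max_{i∈Ω} (|S_i| + r_i)`. -/
theorem stmt_5 {k m n : ℕ} (hm : 1 ≤ m) (hmk : m ≤ k)
    (S : Fin m → Finset (Fin n)) (r : Fin m → ℕ)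
    (hr : ∀ i, 1 ≤ r i) (hcard : ∀ i, (S i).card + r i ≤ k) (hsum : ∑ i, r i = k) :
    (gmM k S r).det ≠ 0 ↔
      ∀ Ω : Finset (Fin m), Ω.Nonempty →
        (Ω.inf S).card + ∑ i ∈ Ω, r i ≤ Ω.sup (fun i => (S i).card + r i) := by
  have he : ∀ i, (S i).card + (k - (S i).card - r i) + r i = k := fun i => by
    have := hcard i
    omega
  have hsup : ∀ Ω : Finset (Fin m), Ω.Nonempty →
      ((Ω.inf S).card + ∑ i ∈ Ω, r i ≤ Ω.sup (fun i => (S i).card + r i) ↔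
        ∃ i ∈ Ω, (Ω.inf S).card + (k - (S i).card - r i) + ∑ i ∈ Ω, r i ≤ k) := by
    intro Ω hΩ
    constructor
    · obtain ⟨i, hi, heq⟩ := Finset.exists_mem_eq_sup Ω hΩ fun i => (S i).card + r i
      intro h
      have := hcard i
      exact ⟨i, hi, by omega⟩
    · rintro ⟨i, hi, hle⟩
      have := hcard i
      have := Finset.le_sup (f := fun i => (S i).card + r i) hi
      omega
  rw [gmM_eq_submatrix hcard hsum, Matrix.det_submatrix_equiv_self, ← RingHom.mapMatrix_apply,
    ← RingHom.map_det, map_ne_zero_iff _ (IsFractionRing.injective _ _),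
    det_blockMatrix_ne_zero_iff he hsum]
  constructor
  · exact fun h Ω hΩ => (hsup Ω hΩ).2 (h.exists_card_inf_add_sum_le he hΩ)
  · exact fun h => MultiplicityCondition.onlyTrivialRelation (k := k)
      ⟨fun i _ => ⟨hr i, he i⟩, fun Ω _ hΩ => (hsup Ω hΩ).1 (h Ω hΩ)⟩
end

section
/- Let [(S_i,r_i)]_{i=1}^m ∈ 𝒮_{k,m,n}, and suppose there exists a nonempty Ω ⊆ {1,…,m} with |∩_{i∈Ω} S_i| + ∑_{i∈Ω} r_i > max_{i∈Ω}(|S_i| + r_i). Then, with S_0 = ∩_{i∈Ω} S_i, r_0 = ∑_{i∈Ω} r_i, and k' = max_{i∈Ω}(|S_i| + r_i), the r_0 × k' submatrix M_0 of M[(S_i,r_i)]_{i=1}^m consisting of the rows of the blocks indexed by Ω and the first k' columns satisfies rank M_0 ≤ k' − min{k', |S_0|} < r_0; consequently det M[(S_i,r_i)]_{i=1}^m = 0. -/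
open Polynomial

/-- The product `∏_{j ∈ S} (x + α_j)`. -/
noncomputable def linearProd {n : ℕ} (S : Finset (Fin n)) : Polynomial (Kn n) :=
  ∏ j ∈ S, (X + C (alf j))

theorem natDegree_linearProd {n : ℕ} (S : Finset (Fin n)) :
    (linearProd S).natDegree = S.card := by
  rw [linearProd, natDegree_prod_of_monic _ _ fun j _ => monic_X_add_C _]
  simp

/-- The cofactor of `x^(k-k') * ∏_{j ∈ T} (x + α_j)` in the polynomial whose coefficients form
row `t` of the block of `S`. -/
noncomputable def rowCofactor {n : ℕ} (k' : ℕ) (T S : Finset (Fin n)) (t : ℕ) :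
    Polynomial (Kn n) :=
  X ^ (k' - 1 - S.card - t) * linearProd (S \ T)

theorem natDegree_rowCofactor_lt {n k' t : ℕ} {T S : Finset (Fin n)} (hTS : T ⊆ S)
    (ht : S.card + t < k') : (rowCofactor k' T S t).natDegree < k' - T.card := by
  have h := natDegree_mul_le (p := X ^ (k' - 1 - S.card - t)) (q := linearProd (S \ T))
  rw [natDegree_X_pow, natDegree_linearProd] at h
  have h1 := Finset.card_sdiff_add_card_eq_card hTS
  unfold rowCofactor
  omega

theorem rowPoly_eq {n k k' t : ℕ} {T S : Finset (Fin n)} (hTS : T ⊆ S)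
    (ht : S.card + t < k') (hk : k' ≤ k) :
    rowPoly k S = X ^ t * (rowCofactor k' T S t * (X ^ (k - k') * linearProd T)) := by
  have h : k - S.card - 1 = t + (k' - 1 - S.card - t) + (k - k') := by omega
  rw [rowPoly, rowCofactor, linearProd, linearProd, ← Finset.prod_sdiff hTS, h, pow_add, pow_add]
  ring

theorem row_entry_eq {n k k' t c : ℕ} {T S : Finset (Fin n)} (hTS : T ⊆ S)
    (ht : S.card + t < k') (hk : k' ≤ k) (hc : c < k) :
    (if t ≤ c then (rowPoly k S).coeff (k - 1 - c + t) else 0) =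
      ∑ u : Fin (k' - T.card), (rowCofactor k' T S t).coeff u *
        (X ^ (u : ℕ) * (X ^ (k - k') * linearProd T)).coeff (k - 1 - c) := by
  have hcof := natDegree_rowCofactor_lt hTS ht
  have hsum : ∑ u : Fin (k' - T.card), (rowCofactor k' T S t).coeff u *
        (X ^ (u : ℕ) * (X ^ (k - k') * linearProd T)).coeff (k - 1 - c) =
      (rowCofactor k' T S t * (X ^ (k - k') * linearProd T)).coeff (k - 1 - c) := by
    conv_rhs => rw [(rowCofactor k' T S t).as_sum_range_C_mul_X_pow' hcof]
    simp only [Finset.sum_mul, finsetSum_coeff, mul_assoc, coeff_C_mul]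
    rw [Finset.sum_range]
  rw [hsum]
  split_ifs with htc
  · rw [rowPoly_eq hTS ht hk, coeff_X_pow_mul]
  · refine (coeff_eq_zero_of_natDegree_lt ?_).symm
    have h := natDegree_mul_le (p := rowCofactor k' T S t) (q := X ^ (k - k') * linearProd T)
    have h1 := natDegree_mul_le (p := X ^ (k - k')) (q := linearProd T)
    have h2 := natDegree_mul_le (p := X ^ (k' - 1 - S.card - t)) (q := linearProd (S \ T))
    rw [natDegree_X_pow, natDegree_linearProd] at h1 h2
    have h3 := Finset.card_sdiff_add_card_eq_card hTS
    change (rowCofactor k' T S t).natDegree ≤ _ at h2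
    omega

/-- Rows whose polynomials share the factor `x^(k-k') * ∏_{j ∈ T} (x + α_j)` span a space of
dimension at most `k' - |T|`, on any set of columns. -/
theorem rank_rows_le {n k k' : ℕ} {ι κ : Type*} [Fintype κ] (T : Finset (Fin n))
    (S : ι → Finset (Fin n)) (t : ι → ℕ) (c : κ → ℕ) (hTS : ∀ p, T ⊆ S p)
    (ht : ∀ p, (S p).card + t p < k') (hk : k' ≤ k) (hc : ∀ q, c q < k) :
    (Matrix.of fun (p : ι) (q : κ) =>
      if t p ≤ c q then (rowPoly k (S p)).coeff (k - 1 - c q + t p) else 0).rank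
      ≤ k' - T.card := by
  have h : (Matrix.of fun (p : ι) (q : κ) =>
      if t p ≤ c q then (rowPoly k (S p)).coeff (k - 1 - c q + t p) else 0) =
      (Matrix.of fun (p : ι) (u : Fin (k' - T.card)) =>
        (rowCofactor k' T (S p) (t p)).coeff u) *
      Matrix.of fun (u : Fin (k' - T.card)) (q : κ) =>
        (X ^ (u : ℕ) * (X ^ (k - k') * linearProd T)).coeff (k - 1 - c q) := by
    ext p q
    simp only [Matrix.mul_apply, Matrix.of_apply]
    exact row_entry_eq (hTS p) (ht p) hk (hc q)
  rw [h]
  exact (Matrix.rank_mul_le_right _ _).trans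
    ((Matrix.rank_le_card_height _).trans (Fintype.card_fin _).le)

theorem off_add_le_off {m : ℕ} (r : Fin m → ℕ) {i j : Fin m} (hij : i < j) :
    off r i + r i ≤ off r j := by
  have hi : i ∉ Finset.univ.filter (· < i) := by simp
  rw [off, off, add_comm, ← Finset.sum_insert hi]
  refine Finset.sum_le_sum_of_subset fun a ha => ?_
  simp only [Finset.mem_insert, Finset.mem_filter, Finset.mem_univ, true_and] at ha ⊢
  rcases ha with rfl | ha
  exacts [hij, ha.trans hij]

theorem off_add_le_sum {m : ℕ} (r : Fin m → ℕ) (i : Fin m) : off r i + r i ≤ ∑ j, r j := by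
  have hi : i ∉ Finset.univ.filter (· < i) := by simp
  rw [off, add_comm, ← Finset.sum_insert hi]
  exact Finset.sum_le_sum_of_subset (Finset.subset_univ _)

theorem eq_of_mem_block {m : ℕ} (r : Fin m → ℕ) {i j : Fin m} {x : ℕ}
    (hi : off r i ≤ x) (hi' : x < off r i + r i) (hj : off r j ≤ x) (hj' : x < off r j + r j) :
    i = j := by
  rcases lt_trichotomy i j with h | h | h
  · have := off_add_le_off r h; omega
  · exact h
  · have := off_add_le_off r h; omega

theorem gmM_apply_block {n m k : ℕ} (S : Fin m → Finset (Fin n)) (r : Fin m → ℕ) (i : Fin m)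
    {t : ℕ} (ht : t < r i) (hk : off r i + t < k) (c : Fin k) :
    gmM k S r ⟨off r i + t, hk⟩ c =
      if t ≤ (c : ℕ) then (rowPoly k (S i)).coeff (k - 1 - (c : ℕ) + t) else 0 := by
  simp only [gmM, Matrix.of_apply]
  rw [Finset.sum_eq_single i]
  · simp [ht]
  · intro j _ hji
    refine if_neg fun h => hji ?_
    exact eq_of_mem_block r h.1 h.2.1 (Nat.le_add_right _ _) (by omega)
  · simp

/-- If some nonempty `Ω ⊆ [m]` violates the GM-MDS condition, i.e.
`|⋂_{i∈Ω} S_i| + ∑_{i∈Ω} r_i > k' := max_{i∈Ω}(|S_i| + r_i)`, then the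
`r_0 × k'` submatrix `M_0` of `M` formed by the rows of the blocks indexed by `Ω`
and the first `k'` columns (here presented with its rows indexed by pairs
`(i, t)` with `i ∈ Ω` and `t < r i`) has `rank M_0 ≤ k' - min k' |S_0| < r_0`,
and consequently `det M[(S_i,r_i)]_{i=1}^m = 0`. -/
theorem stmt_6 {k m n : ℕ} (hm : 1 ≤ m) (hmk : m ≤ k)
    (S : Fin m → Finset (Fin n)) (r : Fin m → ℕ)
    (hr : ∀ i, 1 ≤ r i) (hcard : ∀ i, (S i).card + r i ≤ k) (hsum : ∑ i, r i = k)
    (Ω : Finset (Fin m)) (hΩ : Ω.Nonempty)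
    (hviol : Ω.sup (fun i => (S i).card + r i) < (Ω.inf S).card + ∑ i ∈ Ω, r i) :
    (Matrix.of fun (p : (i : {x // x ∈ Ω}) × Fin (r i.1))
        (c : Fin (Ω.sup fun i => (S i).card + r i)) =>
        if (p.2 : ℕ) ≤ (c : ℕ)
        then (rowPoly k (S p.1.1)).coeff (k - 1 - (c : ℕ) + (p.2 : ℕ)) else 0).rank
        ≤ (Ω.sup fun i => (S i).card + r i)
            - min (Ω.sup fun i => (S i).card + r i) (Ω.inf S).card ∧
    (Ω.sup fun i => (S i).card + r i)
        - min (Ω.sup fun i => (S i).card + r i) (Ω.inf S).card < ∑ i ∈ Ω, r i ∧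
    (gmM k S r).det = 0 := by
  set k' := Ω.sup fun i => (S i).card + r i
  have hle : ∀ i ∈ Ω, (S i).card + r i ≤ k' := fun i hi =>
    Finset.le_sup (f := fun i => (S i).card + r i) hi
  have hkk : k' ≤ k := Finset.sup_le fun i _ => hcard i
  have hT : ∀ i ∈ Ω, Ω.inf S ⊆ S i := fun i hi => Finset.inf_le hi
  have hTk : (Ω.inf S).card ≤ k' := by
    obtain ⟨i, hi⟩ := hΩ
    have := Finset.card_le_card (hT i hi)
    have := hle i hi
    omega
  have ht : ∀ p : (i : {x // x ∈ Ω}) × Fin (r i.1), (S p.1.1).card + (p.2 : ℕ) < k' := fun p => by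
    have := hle p.1.1 p.1.2
    have := p.2.2
    omega
  have hlt : k' - (Ω.inf S).card < ∑ i ∈ Ω, r i := by omega
  rw [min_eq_right hTk]
  refine ⟨rank_rows_le (Ω.inf S) (fun p : (i : {x // x ∈ Ω}) × Fin (r i.1) => S p.1.1)
    (fun p => (p.2 : ℕ)) (fun c : Fin k' => (c : ℕ)) (fun p => hT _ p.1.2) ht hkk
    (fun c => c.2.trans_le hkk), hlt, ?_⟩
  by_contra hdet
  have hli : LinearIndependent (Kn n) (gmM k S r).row :=
    Matrix.linearIndependent_rows_iff_isUnit.2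
      ((Matrix.isUnit_iff_isUnit_det _).2 (isUnit_iff_ne_zero.2 hdet))
  have hrow : ∀ p : (i : {x // x ∈ Ω}) × Fin (r i.1), off r p.1.1 + (p.2 : ℕ) < k := fun p => by
    have := off_add_le_sum r p.1.1
    have := p.2.2
    omega
  let e : ((i : {x // x ∈ Ω}) × Fin (r i.1)) → Fin k := fun p => ⟨_, hrow p⟩
  have he : Function.Injective e := by
    rintro ⟨⟨i, hi⟩, t⟩ ⟨⟨j, hj⟩, u⟩ h
    have h' : off r i + (t : ℕ) = off r j + (u : ℕ) := congrArg Fin.val h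
    have := t.2
    have := u.2
    dsimp only at *
    obtain rfl : i = j := eq_of_mem_block r (x := off r i + (t : ℕ))
      (by omega) (by omega) (by omega) (by omega)
    obtain rfl : t = u := Fin.ext (by omega)
    rfl
  have hrank : ((gmM k S r).submatrix e id).rank = ∑ i ∈ Ω, r i := by
    have h := LinearIndependent.rank_matrix (M := (gmM k S r).submatrix e id) (hli.comp e he)
    rw [h, Fintype.card_sigma]
    simp only [Fintype.card_fin]
    exact Finset.sum_coe_sort Ω r
  have hbound := rank_rows_le (Ω.inf S)
    (fun p : (i : {x // x ∈ Ω}) × Fin (r i.1) => S p.1.1)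
    (fun p => (p.2 : ℕ)) (fun c : Fin k => (c : ℕ)) (fun p => hT _ p.1.2) ht hkk (fun c => c.2)
  have hsub : (gmM k S r).submatrix e id = Matrix.of fun p (c : Fin k) =>
      if (p.2 : ℕ) ≤ (c : ℕ)
      then (rowPoly k (S p.1.1)).coeff (k - 1 - (c : ℕ) + (p.2 : ℕ)) else 0 := by
    ext p c
    exact gmM_apply_block S r p.1.1 p.2.2 (hrow p) c
  rw [← hsub, hrank] at hbound
  omega
end
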